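/- arXiv:1006.3430 — 4 statements merged into one kernel-verified Lean document; each statement's English description precedes it below -/
import Mathlib

section
/- There exist a constant integer d ≥ 10, a constant c > 0, and an infinite family of finite connected simple graphs G=(V,E) with |V|→∞, minimum degree at least d, maximum degree at most 2d, and edge expansion |E(X, V∖X)| ≥ (d/20)·|X| for every X ⊆ V with 1 ≤ |X| ≤ |V|/2, such that for each graph in the family there exist a rotor configuration whose rotor sequences are permutations of the neighbors and a starting vertex for which the rotor walk needs at least c·|V|·log|V| steps to visit every vertex; in particular ṼC(G) ≥ c·|V|·log|V| for these graphs. -/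
/-- A rotor configuration on `G` whose rotor sequence at each vertex `u` is a permutation of
the neighbors of `u` (encoded as a `(deg u)`-periodic map `s u : ℕ → V` that is injective on
`{0, …, deg u − 1}` with all values neighbors of `u`), together with an initial rotor
position `r0 u`. -/
structure PermRotorConfig {V : Type*} [Fintype V] [DecidableEq V]
    (G : SimpleGraph V) [DecidableRel G.Adj] where
  s : V → ℕ → V
  periodic : ∀ u i, s u (i + G.degree u) = s u i
  adj : ∀ u i, i < G.degree u → G.Adj u (s u i)
  inj : ∀ u i j, i < G.degree u → j < G.degree u → s u i = s u j → i = j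
  r0 : V → ℕ

namespace PermRotorConfig

variable {V : Type*} [Fintype V] [DecidableEq V] {G : SimpleGraph V} [DecidableRel G.Adj]

/-- One step of the rotor walk; a state is a pair (current vertex, rotor positions). -/
def step (cfg : PermRotorConfig G) (st : V × (V → ℕ)) : V × (V → ℕ) :=
  (cfg.s st.1 (st.2 st.1), Function.update st.2 st.1 (st.2 st.1 + 1))

/-- The state of the rotor walk started at `x0` after `t` steps. -/
def state (cfg : PermRotorConfig G) (x0 : V) : ℕ → V × (V → ℕ)
  | 0 => (x0, cfg.r0)
  | t + 1 => cfg.step (state cfg x0 t)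

/-- The position of the rotor walk started at `x0` after `t` steps. -/
def pos (cfg : PermRotorConfig G) (x0 : V) (t : ℕ) : V := (cfg.state x0 t).1

/-- Every vertex of `G` is visited within the first `t` steps of the rotor walk
started at `x0`. -/
def coversVertices (cfg : PermRotorConfig G) (x0 : V) (t : ℕ) : Prop :=
  ∀ v : V, ∃ ℓ, ℓ ≤ t ∧ cfg.pos x0 ℓ = v

/-- Every edge of `G` is traversed (in some direction) within the first `t` steps of the
rotor walk started at `x0`. -/
def coversEdges (cfg : PermRotorConfig G) (x0 : V) (t : ℕ) : Prop :=
  ∀ u v : V, G.Adj u v → ∃ ℓ, 1 ≤ ℓ ∧ ℓ ≤ t ∧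
    ((cfg.pos x0 (ℓ - 1) = u ∧ cfg.pos x0 ℓ = v) ∨
     (cfg.pos x0 (ℓ - 1) = v ∧ cfg.pos x0 ℓ = u))

end PermRotorConfig

namespace RotorAux

open Finset

/-- A periodic enumeration of a finite set sorted by a key. -/
lemma exists_sorted {V : Type*} [DecidableEq V] (u : V) (S : Finset V) (key : V → ℕ) :
    ∃ f : ℕ → V, (∀ i, f (i + S.card) = f i) ∧ (∀ i, i < S.card → f i ∈ S) ∧
      (∀ i j, i < S.card → j < S.card → f i = f j → i = j) ∧
      (∀ w ∈ S, ∃ i, i < S.card ∧ f i = w) ∧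
      (∀ i j, i ≤ j → j < S.card → key (f i) ≤ key (f j)) := by
  classical
  let e := S.equivFin.symm
  let σ := Tuple.sort (fun i => key (e i))
  have hmono : Monotone ((fun i => key (e i)) ∘ σ) := Tuple.monotone_sort _
  by_cases h : 0 < S.card
  · refine ⟨fun i => (e (σ ⟨i % S.card, Nat.mod_lt _ h⟩) : V), ?_, ?_, ?_, ?_, ?_⟩
    · intro i; simp
    · intro i _; exact (e _).2
    · intro i j hi hj hij
      have h1 := e.injective (Subtype.ext hij)
      have h2 := σ.injective h1
      simpa [Nat.mod_eq_of_lt hi, Nat.mod_eq_of_lt hj] using h2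
    · intro w hw
      refine ⟨(σ.symm (e.symm ⟨w, hw⟩)).1, (σ.symm (e.symm ⟨w, hw⟩)).2, ?_⟩
      have : (⟨(σ.symm (e.symm ⟨w, hw⟩)).1 % S.card, Nat.mod_lt _ h⟩ : Fin S.card)
          = σ.symm (e.symm ⟨w, hw⟩) := by
        ext; simp [Nat.mod_eq_of_lt (σ.symm (e.symm ⟨w, hw⟩)).2]
      simp only [this]
      simp
    · intro i j hij hj
      have hi := lt_of_le_of_lt hij hj
      apply hmono
      simp [Fin.le_def, Nat.mod_eq_of_lt hi, Nat.mod_eq_of_lt hj, hij]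
  · have h0 : S.card = 0 := by omega
    refine ⟨fun _ => u, fun _ => rfl, ?_, ?_, ?_, fun _ _ _ _ => le_rfl⟩
    · intro i hi; omega
    · intro i j hi; omega
    · intro w hw
      have := Finset.card_pos.2 ⟨w, hw⟩
      omega

/-- The number of times `w` occurs among the first `m` values. -/
def cnt {V : Type*} [DecidableEq V] (f : ℕ → V) (m : ℕ) (w : V) : ℕ :=
  Nat.count (fun i => f i = w) m

lemma cnt_mono {V : Type*} [DecidableEq V] (f : ℕ → V) {m m' : ℕ} (h : m ≤ m') (w : V) :
    cnt f m w ≤ cnt f m' w := Nat.count_monotone _ h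

lemma lt_cnt_iff {V : Type*} [DecidableEq V] (f : ℕ → V) (D : ℕ)
    (hper : ∀ i, f (i + D) = f i)
    (hinj : ∀ i j, i < D → j < D → f i = f j → i = j) (k : ℕ) (hk : k < D) (m c : ℕ) :
    c < cnt f m (f k) ↔ c * D + k < m := by
  have hD : 0 < D := by omega
  have h1 : cnt f m (f k) = Nat.count (· ≡ k [MOD D]) m := by
    unfold cnt
    congr 1
    ext i
    have hp : Function.Periodic f D := hper
    rw [← hp.map_mod_nat i]
    unfold Nat.ModEq
    rw [Nat.mod_eq_of_lt hk]
    constructor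
    · intro h; exact hinj _ _ (Nat.mod_lt _ hD) hk h
    · intro h; rw [h]
  rw [h1, Nat.count_modEq_card _ hD, Nat.mod_eq_of_lt hk]
  have h2 := Nat.div_add_mod m D
  have h3 := Nat.mod_lt m hD
  generalize m / D = q at *
  generalize m % D = r at *
  subst h2
  constructor
  · intro h
    split_ifs at h with hkr
    · have : c * D ≤ q * D := Nat.mul_le_mul_right _ (by omega)
      nlinarith
    · have : (c + 1) * D ≤ q * D := Nat.mul_le_mul_right _ (by omega)
      nlinarith
  · intro h
    by_contra hcon
    split_ifs at hcon with hkr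
    · have : (q + 1) * D ≤ c * D := Nat.mul_le_mul_right _ (by omega)
      nlinarith
    · have : q * D ≤ c * D := Nat.mul_le_mul_right _ (by omega)
      nlinarith

variable {V : Type*} [Fintype V] [DecidableEq V] {G : SimpleGraph V} [DecidableRel G.Adj]

/-- exit counts -/
def ex (cfg : PermRotorConfig G) (x0 : V) (t : ℕ) (v : V) : ℕ := (cfg.state x0 t).2 v

lemma pos_succ (cfg : PermRotorConfig G) (x0 : V) (t : ℕ) :
    cfg.pos x0 (t + 1) = cfg.s (cfg.pos x0 t) (ex cfg x0 t (cfg.pos x0 t)) := rfl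

lemma ex_succ (cfg : PermRotorConfig G) (x0 : V) (t : ℕ) (v : V) :
    ex cfg x0 (t + 1) v = ex cfg x0 t v + if v = cfg.pos x0 t then 1 else 0 := by
  have h1 : ex cfg x0 (t + 1) v = Function.update (cfg.state x0 t).2 (cfg.pos x0 t)
      (ex cfg x0 t (cfg.pos x0 t) + 1) v := rfl
  rw [h1, Function.update_apply]
  by_cases h : v = cfg.pos x0 t
  · rw [if_pos h, if_pos h, ← h]
  · rw [if_neg h, if_neg h]; rfl

lemma ex_mono (cfg : PermRotorConfig G) (x0 : V) (v : V) {t t' : ℕ} (h : t ≤ t') :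
    ex cfg x0 t v ≤ ex cfg x0 t' v := by
  apply monotone_nat_of_le_succ (f := fun t => ex cfg x0 t v) _ h
  intro n; simp only [ex_succ]; omega

lemma sum_ex (cfg : PermRotorConfig G) (h0 : cfg.r0 = fun _ => 0) (x0 : V) (t : ℕ) :
    ∑ v, ex cfg x0 t v = t := by
  induction t with
  | zero => simp [ex, PermRotorConfig.state, h0]
  | succ t ih => simp [ex_succ, Finset.sum_add_distrib, ih]

lemma balance (cfg : PermRotorConfig G) (h0 : cfg.r0 = fun _ => 0) (x0 : V) (t : ℕ) (u : V) :
    (∑ v, cnt (cfg.s v) (ex cfg x0 t v) u) + (if u = x0 then 1 else 0)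
      = ex cfg x0 t u + if u = cfg.pos x0 t then 1 else 0 := by
  induction t with
  | zero => simp [ex, PermRotorConfig.state, h0, cnt, PermRotorConfig.pos]
  | succ t ih =>
    have h1 : ∀ v, cnt (cfg.s v) (ex cfg x0 (t+1) v) u = cnt (cfg.s v) (ex cfg x0 t v) u +
        if v = cfg.pos x0 t then (if u = cfg.pos x0 (t+1) then 1 else 0) else 0 := by
      intro v
      rw [ex_succ]
      by_cases hv : v = cfg.pos x0 t
      · subst hv
        simp only [if_true]
        unfold cnt
        rw [Nat.count_succ, pos_succ]
        simp only [eq_comm]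
      · simp [hv]
    rw [Finset.sum_congr rfl fun v _ => h1 v, Finset.sum_add_distrib, Finset.sum_ite_eq',
      if_pos (Finset.mem_univ _), ex_succ]
    omega

lemma least_action (cfg : PermRotorConfig G) (h0 : cfg.r0 = fun _ => 0) (x0 : V) (B : V → ℕ)
    (hB : ∀ u, u ≠ x0 → ∑ v, cnt (cfg.s v) (B v) u ≤ B u) (t : ℕ)
    (ht : ex cfg x0 t x0 ≤ B x0) : ∀ v, ex cfg x0 t v ≤ B v := by
  induction t with
  | zero => intro v; simp [ex, PermRotorConfig.state, h0]
  | succ t ih =>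
    have ih' := ih ((ex_mono cfg x0 x0 (Nat.le_succ t)).trans ht)
    intro v
    by_cases hv : v = x0
    · rw [hv]; exact ht
    rw [ex_succ]
    split_ifs with hp
    · have hb := balance cfg h0 x0 t v
      rw [if_neg hv, if_pos hp] at hb
      rw [← hb]
      refine le_trans ?_ (hB v hv)
      simp only [add_zero]
      exact Finset.sum_le_sum fun w _ => cnt_mono _ (ih' w) _
    · exact ih' v

open Classical in
theorem rotor_lower (G : SimpleGraph V) [DecidableRel G.Adj] (hdeg : ∀ v, 0 < G.degree v)
    (lev : V → ℕ) (hlev : ∀ u v, G.Adj u v → lev u ≤ lev v + 1) (C : Finset V) (x0 : V) (hx0 : x0 ∈ C)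
    (hC : ∀ v ∈ C, lev v = 0) (par : V → V) (dep : V → ℕ)
    (hpar : ∀ v ∈ C, v ≠ x0 → par v ∈ C ∧ G.Adj v (par v) ∧ dep (par v) < dep v)
    (z : V) (p : ℕ) (hp : 1 ≤ p) (hz : lev z = p + 1) :
    ∃ cfg : PermRotorConfig G, ∀ t, cfg.coversVertices x0 t → p * ∑ v ∈ C, G.degree v ≤ t := by
  let key : V → V → ℕ := fun u w =>
    if lev w < lev u then 0 else if lev u = 0 ∧ w = par u then 2 else 1
  have hex := fun u => exists_sorted u (G.neighborFinset u) (key u)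
  simp only [SimpleGraph.card_neighborFinset_eq_degree] at hex
  choose f hper hmem hinj hsurj hmon using hex
  let cfg : PermRotorConfig G :=
    { s := f
      periodic := hper
      adj := fun u i hi => by simpa using hmem u i hi
      inj := hinj
      r0 := fun _ => 0 }
  have h0 : cfg.r0 = fun _ => 0 := rfl
  have hs : cfg.s = f := rfl
  refine ⟨cfg, fun t hcov => ?_⟩
  let down : V → ℕ := fun v => ((G.neighborFinset v).filter fun w => lev w < lev v).card
  have hdown_le : ∀ v, down v ≤ G.degree v := fun v => by
    rw [← SimpleGraph.card_neighborFinset_eq_degree]; exact Finset.card_filter_le _ _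
  have hdown0 : ∀ v, lev v = 0 → down v = 0 := fun v hv => by
    simp [down, hv]
  -- count zero for non-neighbours
  have hnon : ∀ v u m, ¬ G.Adj v u → cnt (f v) m u = 0 := by
    intro v u m h
    unfold cnt
    rw [Nat.count_eq_card_filter_range, Finset.card_eq_zero, Finset.filter_eq_empty_iff]
    intro i _ hi
    · have hd := hdeg v
      have hpr : Function.Periodic (f v) (G.degree v) := hper v
      rw [← hpr.map_mod_nat i] at hi
      have := hmem v (i % G.degree v) (Nat.mod_lt _ (by omega))
      rw [hi] at this
      exact h (by simpa using this)
  -- counts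
  have hcnt1 : ∀ v u m q, m ≤ q * G.degree v → cnt (f v) m u ≤ q := by
    intro v u m q hm
    by_cases hadj : G.Adj v u
    · obtain ⟨k, hk, rfl⟩ := hsurj v u (by simpa using hadj)
      by_contra hcon
      have := (lt_cnt_iff (f v) _ (hper v) (hinj v) k hk m q).1 (by omega)
      omega
    · rw [hnon v u m hadj]; omega
  have hcnt2 : ∀ v u m q, m ≤ q * G.degree v + down v →
      cnt (f v) m u ≤ q + if lev u < lev v then 1 else 0 := by
    intro v u m q hm
    split_ifs with hl
    · apply hcnt1
      have := hdown_le v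
      rw [Nat.add_mul]; omega
    · by_cases hadj : G.Adj v u
      · obtain ⟨k, hk, rfl⟩ := hsurj v u (by simpa using hadj)
        have hdk : down v ≤ k := by
          have hsub : (G.neighborFinset v).filter (fun w => lev w < lev v)
              ⊆ (Finset.range k).image (f v) := by
            intro w hw
            rw [Finset.mem_filter] at hw
            obtain ⟨j, hj, rfl⟩ := hsurj v w hw.1
            refine Finset.mem_image_of_mem _ ?_
            rw [Finset.mem_range]
            by_contra hjk
            have := hmon v k j (by omega) hj
            simp only [key, if_neg hl, if_pos hw.2] at this
            split_ifs at this <;> omega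
          calc down v ≤ _ := Finset.card_le_card hsub
            _ ≤ _ := Finset.card_image_le
            _ = k := by simp
        by_contra hcon
        have := (lt_cnt_iff (f v) _ (hper v) (hinj v) k hk m q).1 (by omega)
        omega
      · rw [hnon v u m hadj]; omega
  have hlast : ∀ v ∈ C, v ≠ x0 → ∀ m, p ≤ cnt (f v) m (par v) → p * G.degree v ≤ m := by
    intro v hv hne m hm
    have hadj := (hpar v hv hne).2.1
    obtain ⟨k, hk, hkp⟩ := hsurj v (par v) (by simpa using hadj)
    have hkey : key v (par v) = 2 := by
      simp [key, hC v hv]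
    have hk2 : k = G.degree v - 1 := by
      by_contra hne2
      have h1 := hmon v k (G.degree v - 1) (by omega) (by omega)
      rw [hkp, hkey] at h1
      have h2 : f v (G.degree v - 1) = par v := by
        by_contra h3
        simp only [key, h3, and_false, if_false] at h1
        split_ifs at h1 <;> omega
      have := hinj v k (G.degree v - 1) hk (by omega) (by rw [hkp, h2])
      omega
    rw [← hkp] at hm
    have := (lt_cnt_iff (f v) _ (hper v) (hinj v) k hk m (p-1)).1 (by omega)
    obtain ⟨p', rfl⟩ : ∃ p', p = p' + 1 := ⟨p - 1, by omega⟩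
    simp only [Nat.add_sub_cancel] at this
    rw [Nat.add_mul]; omega
  let B : V → ℕ := fun v => if lev v ≤ p then (p - lev v) * G.degree v + down v else 0
  have hBp : ∀ v, B v ≤ p * G.degree v := by
    intro v
    simp only [B]
    split_ifs with h
    · by_cases hv : lev v = 0
      · simp [hv, hdown0 v hv]
      · have h1 : (p - lev v + 1) * G.degree v ≤ p * G.degree v :=
          Nat.mul_le_mul_right _ (by omega)
        have := hdown_le v
        rw [Nat.add_mul] at h1; omega
    · exact Nat.zero_le _
  have hB : ∀ u, u ≠ x0 → ∑ v, cnt (cfg.s v) (B v) u ≤ B u := by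
    intro u _
    rw [hs]
    have hterm : ∀ v, cnt (f v) (B v) u ≤ if G.Adj u v then
        (if lev u ≤ p then (p - lev u) + (if lev v < lev u then 1 else 0) else 0) else 0 := by
      intro v
      by_cases hadj : G.Adj u v
      · rw [if_pos hadj]
        have h1 := hlev u v hadj
        have h2 := hlev v u hadj.symm
        by_cases hvp : lev v ≤ p
        · have h3 := hcnt2 v u (B v) (p - lev v) (by simp [B, hvp])
          refine h3.trans ?_
          split_ifs <;> omega
        · have : B v = 0 := by simp [B, hvp]
          rw [this]; simp [cnt]
      · rw [if_neg hadj, hnon v u _ (fun h => hadj h.symm)]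
    refine (Finset.sum_le_sum fun v _ => hterm v).trans ?_
    rw [← Finset.sum_filter]
    have hnb : (Finset.univ.filter fun v => G.Adj u v) = G.neighborFinset u := by
      ext; simp
    rw [hnb]
    simp only [B]
    split_ifs with hu
    · rw [Finset.sum_add_distrib, Finset.sum_const, SimpleGraph.card_neighborFinset_eq_degree,
        smul_eq_mul, ← Finset.card_filter, mul_comm]
    · simp
  have hx0lev := hC x0 hx0
  have hBx0 : B x0 = p * G.degree x0 := by
    simp [B, hx0lev, hdown0 x0 hx0lev]
  -- the time z is visited
  obtain ⟨l, hl, hlz⟩ := hcov z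
  have hzx : z ≠ x0 := by intro h; rw [h, hx0lev] at hz; omega
  have hexz : ¬ ex cfg x0 (l+1) z ≤ B z := by
    have : B z = 0 := by simp [B, hz]
    rw [this, ex_succ, hlz]; simp
  have hbig : ¬ ex cfg x0 (l+1) x0 ≤ p * G.degree x0 := by
    intro h
    rw [← hBx0] at h
    exact hexz (least_action cfg h0 x0 B hB _ h z)
  obtain ⟨t0, ht0l, ht0a, ht0b⟩ : ∃ t0, t0 ≤ l ∧ ex cfg x0 t0 x0 ≤ p * G.degree x0 ∧
      ¬ ex cfg x0 (t0+1) x0 ≤ p * G.degree x0 := by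
    have hex : ∃ n, ¬ ex cfg x0 n x0 ≤ p * G.degree x0 := ⟨_, hbig⟩
    have hfind := Nat.find_spec hex
    have hmin : Nat.find hex ≤ l + 1 := Nat.find_min' hex hbig
    have hpos : Nat.find hex ≠ 0 := by
      intro h
      rw [h] at hfind
      apply hfind
      simp [ex, PermRotorConfig.state, h0]
    refine ⟨Nat.find hex - 1, by omega, ?_, ?_⟩
    · have := Nat.find_min hex (m := Nat.find hex - 1) (by omega)
      exact not_not.1 this
    · rw [Nat.sub_add_cancel (by omega)]; exact hfind
  have hposx : cfg.pos x0 t0 = x0 := by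
    by_contra h
    rw [ex_succ, if_neg (fun h' => h h'.symm)] at ht0b
    omega
  have hexx : ex cfg x0 t0 x0 = p * G.degree x0 := by
    rw [ex_succ, if_pos hposx.symm] at ht0b
    omega
  have hub := least_action cfg h0 x0 B hB t0 (by rw [hexx, hBx0])
  have hub' : ∀ v, ex cfg x0 t0 v ≤ p * G.degree v := fun v => (hub v).trans (hBp v)
  have hbal : ∀ u, ∑ v, cnt (f v) (ex cfg x0 t0 v) u = ex cfg x0 t0 u := by
    intro u
    have := balance cfg h0 x0 t0 u
    rw [hposx, hs] at this
    omega
  have hkey : ∀ n, ∀ v ∈ C, dep v ≤ n → ex cfg x0 t0 v = p * G.degree v := by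
    intro n
    induction n with
    | zero =>
      intro v hv hd
      by_cases hvx : v = x0
      · rw [hvx]; exact hexx
      · have := (hpar v hv hvx).2.2; omega
    | succ n ih =>
      intro v hv hd
      by_cases hvx : v = x0
      · rw [hvx]; exact hexx
      obtain ⟨hpc, hadj, hdep⟩ := hpar v hv hvx
      have ihp := ih (par v) hpc (by omega)
      have hb := hbal (par v)
      rw [ihp] at hb
      refine le_antisymm (hub' v) (hlast v hv hvx _ ?_)
      by_contra hcon
      have hlt : ∑ w, cnt (f w) (ex cfg x0 t0 w) (par v)
          < ∑ w, if G.Adj (par v) w then p else 0 := by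
        apply Finset.sum_lt_sum
        · intro w _
          split_ifs with h
          · exact hcnt1 w _ _ _ (hub' w)
          · rw [hnon w _ _ (fun h' => h h'.symm)]
        · refine ⟨v, Finset.mem_univ _, ?_⟩
          rw [if_pos hadj.symm]; omega
      rw [hb, ← Finset.sum_filter, Finset.sum_const] at hlt
      have hnb : (Finset.univ.filter fun w => G.Adj (par v) w) = G.neighborFinset (par v) := by
        ext; simp
      rw [hnb, SimpleGraph.card_neighborFinset_eq_degree, smul_eq_mul, mul_comm] at hlt
      omega
  calc p * ∑ v ∈ C, G.degree v = ∑ v ∈ C, ex cfg x0 t0 v := by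
        rw [Finset.mul_sum]
        exact Finset.sum_congr rfl fun v hv => (hkey _ v hv le_rfl).symm
    _ ≤ ∑ v, ex cfg x0 t0 v := Finset.sum_le_sum_of_subset (Finset.subset_univ _)
    _ = t0 := sum_ex cfg h0 x0 t0
    _ ≤ t := by omega

end RotorAux

namespace RotorAux

open Finset

lemma exists_pred {V : Type*} (H : SimpleGraph V) (x v : V) (h : H.Reachable x v) (hne : v ≠ x) :
    ∃ u, H.Adj v u ∧ H.Reachable x u ∧ H.dist x u < H.dist x v := by
  obtain ⟨q, hq⟩ := h.symm.exists_walk_length_eq_dist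
  cases q with
  | nil => exact absurd rfl hne
  | @cons _ u _ hadj q =>
    refine ⟨u, hadj, q.reachable.symm, ?_⟩
    rw [H.dist_comm (u := x) (v := v), ← hq, H.dist_comm]
    have := SimpleGraph.dist_le q
    simp only [SimpleGraph.Walk.length_cons]
    omega

variable {V : Type*} [Fintype V] [DecidableEq V]

open Classical in
lemma ball_card (G : SimpleGraph V) [DecidableRel G.Adj] (hconn : G.Connected)
    (hdeg : ∀ v, G.degree v = 289) (z : V) (r : ℕ) :
    (univ.filter fun v => G.dist z v ≤ r).card ≤ 290 ^ r := by
  induction r with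
  | zero =>
    have : (univ.filter fun v => G.dist z v ≤ 0) ⊆ {z} := by
      intro v hv
      simp only [mem_filter, mem_univ, true_and, Nat.le_zero, hconn.dist_eq_zero_iff] at hv
      simp [hv]
    simpa using card_le_card this
  | succ r ih =>
    have hsub : (univ.filter fun v => G.dist z v ≤ r + 1) ⊆
        (univ.filter fun v => G.dist z v ≤ r).biUnion
          fun u => insert u (G.neighborFinset u) := by
      intro v hv
      simp only [mem_filter, mem_univ, true_and] at hv
      simp only [mem_biUnion, mem_filter, mem_univ, true_and, mem_insert,
        SimpleGraph.mem_neighborFinset]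
      by_cases h : G.dist z v ≤ r
      · exact ⟨v, h, Or.inl rfl⟩
      · have hne : v ≠ z := by
          rintro rfl
          simp at h
        obtain ⟨u, hadj, _, hd⟩ := exists_pred G z v (hconn.preconnected z v) hne
        exact ⟨u, by omega, Or.inr hadj.symm⟩
    calc _ ≤ _ := card_le_card hsub
      _ ≤ (univ.filter fun v => G.dist z v ≤ r).card * 290 := by
        apply card_biUnion_le_card_mul
        intro u _
        refine (card_insert_le _ _).trans ?_
        rw [SimpleGraph.card_neighborFinset_eq_degree, hdeg]
      _ ≤ 290 ^ r * 290 := Nat.mul_le_mul_right _ ih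
      _ = _ := by ring

open Classical in
lemma connected_of_expansion (G : SimpleGraph V) [DecidableRel G.Adj] [Nonempty V]
    (hexp : ∀ X : Finset V, 1 ≤ X.card → 2 * X.card ≤ Fintype.card V →
      ((145 : ℕ) : ℝ) / 20 * (X.card : ℝ) ≤
        (((X ×ˢ Xᶜ).filter fun p => G.Adj p.1 p.2).card : ℝ)) : G.Connected := by
  have key : ∀ X : Finset V, 1 ≤ X.card → 2 * X.card ≤ Fintype.card V →
      ∃ u ∈ X, ∃ v ∉ X, G.Adj u v := by
    intro X h1 h2
    have h := hexp X h1 h2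
    by_contra hcon
    push Not at hcon
    have : ((X ×ˢ Xᶜ).filter fun p => G.Adj p.1 p.2) = ∅ := by
      rw [filter_eq_empty_iff]
      rintro ⟨u, v⟩ huv
      rw [mem_product, mem_compl] at huv
      exact hcon u huv.1 v huv.2
    rw [this] at h
    have h1' : (1 : ℝ) ≤ X.card := by exact_mod_cast h1
    norm_num at h
    linarith
  rw [SimpleGraph.connected_iff]
  refine ⟨?_, inferInstance⟩
  intro a b
  by_contra hab
  let X : Finset V := univ.filter fun v => G.Reachable a v
  have haX : a ∈ X := by simp [X]
  have hbX : b ∈ Xᶜ := by simpa [X] using hab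
  have hcard := card_add_card_compl X
  have hX1 : 1 ≤ X.card := card_pos.2 ⟨a, haX⟩
  have hX2 : 1 ≤ Xᶜ.card := card_pos.2 ⟨b, hbX⟩
  by_cases h : 2 * X.card ≤ Fintype.card V
  · obtain ⟨u, hu, v, hv, hadj⟩ := key X hX1 h
    simp only [X, mem_filter, mem_univ, true_and] at hu hv
    exact hv (hu.trans hadj.reachable)
  · obtain ⟨u, hu, v, hv, hadj⟩ := key Xᶜ hX2 (by omega)
    simp only [X, mem_compl, mem_filter, mem_univ, true_and, not_not] at hu hv
    exact hu (hv.trans hadj.symm.reachable)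

open Classical in
theorem cover_of_expansion (G : SimpleGraph V) [DecidableRel G.Adj] [Nonempty V]
    (hdeg : ∀ v, G.degree v = 289)
    (hexp : ∀ X : Finset V, 1 ≤ X.card → 2 * X.card ≤ Fintype.card V →
      ((145 : ℕ) : ℝ) / 20 * (X.card : ℝ) ≤
        (((X ×ˢ Xᶜ).filter fun p => G.Adj p.1 p.2).card : ℝ))
    (hbig : 2 ^ 37 ≤ Fintype.card V) :
    ∃ (cfg : PermRotorConfig G) (x0 : V), ∀ t : ℕ, cfg.coversVertices x0 t →
      (1 / 18 : ℝ) * (Fintype.card V : ℝ) * Real.logb 2 (Fintype.card V : ℝ) ≤ (t : ℝ) := by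
  have hconn := connected_of_expansion G hexp
  set n := Fintype.card V with hn
  set L := Nat.log 2 n with hL
  have hL37 : 37 ≤ L := Nat.le_log_of_pow_le (by norm_num) hbig
  have hnL : 2 ^ L ≤ n := Nat.pow_log_le_self 2 (by omega)
  set p := (L - 10) / 9 with hp
  have hp1 : 9 * p + 10 ≤ L := by omega
  have hp2 : L + 1 ≤ 18 * p := by omega
  obtain ⟨z⟩ := (inferInstance : Nonempty V)
  let Ball : Finset V := univ.filter fun v => G.dist z v ≤ p
  have hBall : 1000 * Ball.card ≤ n := by
    have h1 := ball_card G hconn hdeg z p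
    calc 1000 * Ball.card ≤ 2 ^ 10 * (2 ^ 9) ^ p := by
          refine Nat.mul_le_mul (by norm_num) (h1.trans ?_)
          exact Nat.pow_le_pow_left (by norm_num) _
      _ = 2 ^ (9 * p + 10) := by rw [← pow_mul, ← pow_add]; ring_nf
      _ ≤ 2 ^ L := Nat.pow_le_pow_right (by norm_num) hp1
      _ ≤ n := hnL
  -- the graph restricted to the complement of the ball
  let H : SimpleGraph V :=
    { Adj := fun u v => G.Adj u v ∧ u ∉ Ball ∧ v ∉ Ball
      symm := ⟨fun u v h => ⟨h.1.symm, h.2.2, h.2.1⟩⟩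
      loopless := ⟨fun u h => G.loopless.irrefl u h.1⟩ }
  have hclosed : ∀ S : Finset V, (∀ u ∈ S, u ∉ Ball) → (∀ u ∈ S, ∀ v, H.Adj u v → v ∈ S) →
      2 * S.card ≤ n → S.card ≤ 40 * Ball.card := by
    intro S hS1 hS2 hS3
    rcases Nat.eq_zero_or_pos S.card with h0 | h0
    · omega
    have h := hexp S h0 hS3
    have hsub : ((S ×ˢ Sᶜ).filter fun q => G.Adj q.1 q.2).card ≤ Ball.card * 289 := by
      have hs : ((S ×ˢ Sᶜ).filter fun q => G.Adj q.1 q.2) ⊆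
          Ball.biUnion fun b => (G.neighborFinset b).image fun u => (u, b) := by
        rintro ⟨u, v⟩ huv
        simp only [mem_filter, mem_product, mem_compl] at huv
        obtain ⟨⟨hu, hv⟩, hadj⟩ := huv
        have hvB : v ∈ Ball := by
          by_contra hvB
          exact hv (hS2 u hu v ⟨hadj, hS1 u hu, hvB⟩)
        simp only [mem_biUnion, mem_image, SimpleGraph.mem_neighborFinset]
        exact ⟨v, hvB, u, hadj.symm, rfl⟩
      refine (card_le_card hs).trans (card_biUnion_le_card_mul _ _ _ ?_)
      intro b _
      refine card_image_le.trans ?_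
      rw [SimpleGraph.card_neighborFinset_eq_degree, hdeg]
    have hsub' : (((S ×ˢ Sᶜ).filter fun q => G.Adj q.1 q.2).card : ℝ) ≤ Ball.card * 289 := by
      exact_mod_cast hsub
    have : (S.card : ℝ) ≤ 40 * Ball.card := by
      have hb0 : (0 : ℝ) ≤ Ball.card := Nat.cast_nonneg _
      push_cast at h
      linarith
    exact_mod_cast this
  -- the giant component
  obtain ⟨x0, hx0B, hx0C⟩ : ∃ x0, x0 ∉ Ball ∧
      n ≤ 4 * (univ.filter fun v => H.Reachable x0 v).card := by
    let fam : Finset (Finset V) := univ.filter fun S =>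
      (∀ u ∈ S, u ∉ Ball) ∧ (∀ u ∈ S, ∀ v, H.Adj u v → v ∈ S) ∧ 2 * S.card ≤ n
    have hne : fam.Nonempty := ⟨∅, by simp [fam]⟩
    obtain ⟨S, hSf, hSmax⟩ := exists_max_image fam card hne
    simp only [fam, mem_filter, mem_univ, true_and] at hSf hSmax
    obtain ⟨hS1, hS2, hS3⟩ := hSf
    have hS4 := hclosed S hS1 hS2 hS3
    obtain ⟨x0, hx0⟩ : ∃ x0, x0 ∉ Ball ∪ S := by
      by_contra hcon
      push Not at hcon
      have : (univ : Finset V).card ≤ (Ball ∪ S).card :=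
        card_le_card fun v _ => hcon v
      have h2 := card_union_le Ball S
      rw [card_univ] at this
      have : 2 ^ 37 ≤ n := hbig
      omega
    rw [mem_union, not_or] at hx0
    refine ⟨x0, hx0.1, ?_⟩
    set C := univ.filter fun v => H.Reachable x0 v with hC
    have hCB : ∀ v ∈ C, v ∉ Ball := by
      intro v hv
      by_cases hvx : v = x0
      · rw [hvx]; exact hx0.1
      · simp only [hC, mem_filter, mem_univ, true_and] at hv
        obtain ⟨u, hadj, _⟩ := exists_pred H x0 v hv hvx
        exact hadj.2.1
    have hunion : ¬ 2 * (S ∪ C).card ≤ n := by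
      intro h
      have hle := hSmax (S ∪ C) ⟨?_, ?_, h⟩
      · have hss : S ⊂ S ∪ C := by
          rw [ssubset_iff_of_subset subset_union_left]
          exact ⟨x0, mem_union_right _ (by simp [hC]), hx0.2⟩
        have := card_lt_card hss
        omega
      · intro u hu
        rcases mem_union.1 hu with hu | hu
        · exact hS1 u hu
        · exact hCB u hu
      · intro u hu v hadj
        rcases mem_union.1 hu with hu | hu
        · exact mem_union_left _ (hS2 u hu v hadj)
        · refine mem_union_right _ ?_
          simp only [hC, mem_filter, mem_univ, true_and] at hu ⊢
          exact hu.trans hadj.reachable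
    have h2 := card_union_le S C
    omega
  set C := univ.filter fun v => H.Reachable x0 v with hC
  have hCB : ∀ v ∈ C, v ∉ Ball := by
    intro v hv
    by_cases hvx : v = x0
    · rw [hvx]; exact hx0B
    · simp only [hC, mem_filter, mem_univ, true_and] at hv
      obtain ⟨u, hadj, _⟩ := exists_pred H x0 v hv hvx
      exact hadj.2.1
  have hpar : ∀ v, ∃ u, v ∈ C → v ≠ x0 → u ∈ C ∧ G.Adj v u ∧ H.dist x0 u < H.dist x0 v := by
    intro v
    by_cases h : v ∈ C ∧ v ≠ x0
    · have hv := h.1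
      simp only [hC, mem_filter, mem_univ, true_and] at hv
      obtain ⟨u, hadj, hr, hd⟩ := exists_pred H x0 v hv h.2
      refine ⟨u, fun _ _ => ⟨by simpa [hC] using hr, hadj.1, hd⟩⟩
    · exact ⟨v, fun h1 h2 => absurd ⟨h1, h2⟩ h⟩
  choose par hpar using hpar
  obtain ⟨cfg, hcfg⟩ := rotor_lower G (fun v => by rw [hdeg]; norm_num)
    (fun v => p + 1 - G.dist z v) (by
      intro u v hadj
      have h1 := hconn.dist_triangle (u := z) (v := u) (w := v)
      have h2 : G.dist u v = 1 := SimpleGraph.dist_eq_one_iff_adj.2 hadj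
      omega) C x0 (by simp [hC]) (by
      intro v hv
      have := hCB v hv
      simp only [Ball, mem_filter, mem_univ, true_and] at this
      omega) par (fun v => H.dist x0 v) hpar z p (by omega) (by simp)
  refine ⟨cfg, x0, fun t ht => ?_⟩
  have h := hcfg t ht
  simp only [hdeg, sum_const, smul_eq_mul] at h
  have h18 : n * (L + 1) ≤ 18 * t := by
    calc n * (L + 1) ≤ (4 * C.card) * (18 * p) := Nat.mul_le_mul hx0C hp2
      _ ≤ 18 * (p * (C.card * 289)) := by nlinarith [Nat.zero_le (p * C.card)]
      _ ≤ 18 * t := Nat.mul_le_mul_left _ h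
  have hlog : Real.logb 2 (n : ℝ) ≤ L + 1 := by
    have hlt : n < 2 ^ (L + 1) := Nat.lt_pow_succ_log_self (by norm_num) n
    have hnpos : (0 : ℝ) < n := by
      have : 0 < n := by omega
      exact_mod_cast this
    rw [Real.logb_le_iff_le_rpow (by norm_num) hnpos]
    have : (n : ℝ) ≤ (2 : ℝ) ^ (L + 1) := by exact_mod_cast hlt.le
    calc (n : ℝ) ≤ (2 : ℝ) ^ (L + 1) := this
      _ = (2 : ℝ) ^ ((L : ℝ) + 1) := by
        rw [← Real.rpow_natCast]; push_cast; rfl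
  have h18' : (n : ℝ) * (L + 1) ≤ 18 * t := by exact_mod_cast h18
  have : (n : ℝ) * Real.logb 2 n ≤ n * (L + 1) :=
    mul_le_mul_of_nonneg_left hlog (Nat.cast_nonneg _)
  linarith

end RotorAux

namespace RotorAux

open Finset

/-- torus -/
abbrev Tor (n : ℕ) : Type := ZMod n × ZMod n

def sh1 (n : ℕ) (k : ZMod n) : Equiv.Perm (Tor n) where
  toFun z := (z.1 + k * z.2, z.2)
  invFun z := (z.1 - k * z.2, z.2)
  left_inv z := by simp
  right_inv z := by simp

def sh2 (n : ℕ) (k : ZMod n) : Equiv.Perm (Tor n) where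
  toFun z := (z.1, z.2 + k * z.1)
  invFun z := (z.1, z.2 - k * z.1)
  left_inv z := by simp
  right_inv z := by simp

/-- size of a residue -/
def sz {n : ℕ} (a : ZMod n) : ℕ := a.valMinAbs.natAbs

/-- weights -/
noncomputable def kap (s t : ℕ) : ℝ := if t < s then 3 / 2 else if s < t then 2 / 3 else 1

lemma kap_le (s t : ℕ) : kap s t ≤ 3 / 2 := by
  unfold kap; split_ifs <;> norm_num
lemma kap_pos (s t : ℕ) : 0 < kap s t := by
  unfold kap; split_ifs <;> norm_num
lemma kap_mul (s t : ℕ) : kap s t * kap t s = 1 := by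
  unfold kap; split_ifs <;> first | omega | norm_num
lemma kap_inc {s t : ℕ} (h : s < t) : kap s t = 2 / 3 := by
  unfold kap; rw [if_neg (by omega), if_pos h]
lemma kap_eq {s t : ℕ} (h : s = t) : kap s t = 1 := by
  unfold kap; rw [if_neg (by omega), if_neg (by omega)]

lemma amgm (s t : ℕ) (p q : ℝ) : 2 * (p * q) ≤ kap s t * p ^ 2 + kap t s * q ^ 2 := by
  have h := kap_mul s t
  have h1 := kap_pos s t
  have h2 := kap_pos t s
  have h3 : kap t s = (kap s t)⁻¹ := by
    exact eq_inv_of_mul_eq_one_right h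
  rw [h3]
  have : kap s t * p ^ 2 + (kap s t)⁻¹ * q ^ 2 - 2 * (p * q)
      = (kap s t)⁻¹ * (kap s t * p - q) ^ 2 := by
    field_simp; ring
  have h4 : 0 ≤ (kap s t)⁻¹ * (kap s t * p - q) ^ 2 := by positivity
  linarith

lemma sz_cases (n : ℕ) [NeZero n] (A B : ℤ) (h : 2 * (A.natAbs + B.natAbs) < n) :
    (B.natAbs < (B + 2 * A).natAbs → B.natAbs < sz ((B + 2 * A : ℤ) : ZMod n)) ∧
    (B.natAbs = (B + 2 * A).natAbs → B.natAbs = sz ((B + 2 * A : ℤ) : ZMod n)) := by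
  set w := ((B + 2 * A : ℤ) : ZMod n) with hw
  have h1 : ((w.valMinAbs : ℤ) : ZMod n) = ((B + 2 * A : ℤ) : ZMod n) := by
    rw [ZMod.coe_valMinAbs]
  rw [ZMod.intCast_eq_intCast_iff_dvd_sub] at h1
  obtain ⟨q, hq⟩ := h1
  have h2 := ZMod.valMinAbs_mem_Ioc w
  rw [Set.mem_Ioc] at h2
  unfold sz
  generalize w.valMinAbs = W at *
  have hnpos : (0 : ℤ) < n := by have := NeZero.pos n; omega
  have hq1 : q < 2 := by
    by_contra hc
    have : (n : ℤ) * 2 ≤ n * q := mul_le_mul_of_nonneg_left (by omega) hnpos.le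
    omega
  have hq2 : -2 < q := by
    by_contra hc
    have : (n : ℤ) * q ≤ n * (-2) := mul_le_mul_of_nonneg_left (by omega) hnpos.le
    omega
  have hq3 : q = -1 ∨ q = 0 ∨ q = 1 := by omega
  rcases hq3 with rfl | rfl | rfl <;> constructor <;> intro h5 <;> omega

lemma int_inc {A B : ℤ} (h : A.natAbs < B.natAbs) : A.natAbs < (A + 2 * B).natAbs := by omega
lemma int_inc' {A B : ℤ} (h : A.natAbs < B.natAbs) : A.natAbs < (A + 2 * -B).natAbs := by omega
lemma int_or {A B : ℤ} (h : A ≠ 0) :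
    B.natAbs < (B + 2 * A).natAbs ∨ B.natAbs < (B + 2 * -A).natAbs := by omega

lemma kap_sum_inner (n : ℕ) [NeZero n] (a b : ZMod n) (h : 2 * (sz a + sz b) < n)
    (hne : ¬ (a = 0 ∧ b = 0)) :
    kap (sz b) (sz (b + 2 * a)) + kap (sz b) (sz (b + -2 * a)) +
      kap (sz a) (sz (a + 2 * b)) + kap (sz a) (sz (a + -2 * b)) ≤ 7 / 2 := by
  obtain ⟨A, hA, hA'⟩ : ∃ A : ℤ, a = (A : ZMod n) ∧ sz a = A.natAbs :=
    ⟨a.valMinAbs, (ZMod.coe_valMinAbs a).symm, rfl⟩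
  obtain ⟨B, hB, hB'⟩ : ∃ B : ℤ, b = (B : ZMod n) ∧ sz b = B.natAbs :=
    ⟨b.valMinAbs, (ZMod.coe_valMinAbs b).symm, rfl⟩
  rw [hA', hB'] at h
  have hne' : ¬ (A = 0 ∧ B = 0) := by
    rintro ⟨rfl, rfl⟩
    exact hne ⟨by simpa using hA, by simpa using hB⟩
  have e1 : b + 2 * a = ((B + 2 * A : ℤ) : ZMod n) := by rw [hA, hB]; push_cast; ring
  have e2 : b + -2 * a = ((B + 2 * (-A) : ℤ) : ZMod n) := by rw [hA, hB]; push_cast; ring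
  have e3 : a + 2 * b = ((A + 2 * B : ℤ) : ZMod n) := by rw [hA, hB]; push_cast; ring
  have e4 : a + -2 * b = ((A + 2 * (-B) : ℤ) : ZMod n) := by rw [hA, hB]; push_cast; ring
  obtain ⟨i1, j1⟩ := sz_cases n A B h
  obtain ⟨i2, j2⟩ := sz_cases n (-A) B (by omega)
  obtain ⟨i3, j3⟩ := sz_cases n B A (by omega)
  obtain ⟨i4, j4⟩ := sz_cases n (-B) A (by omega)
  rw [← e1] at i1 j1
  rw [← e2] at i2 j2
  rw [← e3] at i3 j3
  rw [← e4] at i4 j4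
  rw [hA', hB']
  generalize sz (b + 2 * a) = s1 at *
  generalize sz (b + -2 * a) = s2 at *
  generalize sz (a + 2 * b) = s3 at *
  generalize sz (a + -2 * b) = s4 at *
  have b1 := kap_le B.natAbs s1
  have b2 := kap_le B.natAbs s2
  have b3 := kap_le A.natAbs s3
  have b4 := kap_le A.natAbs s4
  rcases lt_trichotomy A.natAbs B.natAbs with hlt | heq | hgt
  · have k3 := kap_inc (i3 (int_inc hlt))
    have k4 := kap_inc (i4 (int_inc' hlt))
    by_cases hz : A = 0
    · have k1 := kap_eq (j1 (by rw [hz]; simp))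
      have k2 := kap_eq (j2 (by rw [hz]; simp))
      linarith
    · rcases int_or (B := B) hz with h5 | h5
      · have k1 := kap_inc (i1 h5); linarith
      · have k1 := kap_inc (i2 h5); linarith
  · have hB0 : B ≠ 0 := by
      rintro rfl
      exact hne' ⟨by simpa using heq, rfl⟩
    have hpos : 0 < B.natAbs := Int.natAbs_pos.2 hB0
    have t1 : B.natAbs < (B + 2 * B).natAbs := by clear * - hpos; omega
    have t2 : B.natAbs = (B + 2 * -B).natAbs := by clear * -; omega
    rcases Int.natAbs_eq_natAbs_iff.1 heq with h5 | h5
    · subst h5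
      have k1 := kap_inc (i1 t1)
      have k2 := kap_eq (j2 t2)
      have k3 := kap_inc (i3 t1)
      have k4 := kap_eq (j4 t2)
      linarith
    · subst h5
      have k1 := kap_eq (j1 t2)
      have k2 := kap_inc (i2 (by rw [neg_neg]; exact t1))
      have k3 := kap_eq (j3 (by clear * -; omega))
      have k4 := kap_inc (i4 (by clear * - hpos; omega))
      linarith
  · have k3 := kap_inc (i1 (int_inc hgt))
    have k4 := kap_inc (i2 (int_inc' hgt))
    by_cases hz : B = 0
    · have k1 := kap_eq (j3 (by rw [hz]; simp))
      have k2 := kap_eq (j4 (by rw [hz]; simp))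
      linarith
    · rcases int_or (B := A) hz with h5 | h5
      · have k1 := kap_inc (i3 h5); linarith
      · have k1 := kap_inc (i4 h5); linarith

/-- the cosine of a frequency -/
noncomputable def cs {n : ℕ} (a : ZMod n) : ℝ := Real.cos (2 * Real.pi * (a.valMinAbs : ℝ) / n)

lemma cs_eq {n : ℕ} (a : ZMod n) : cs a = Real.cos (2 * Real.pi * (sz a : ℝ) / n) := by
  unfold cs sz
  rw [Nat.cast_natAbs, Int.cast_abs]
  rcases abs_choice (a.valMinAbs : ℝ) with h | h
  · rw [h]
  · rw [h, ← Real.cos_neg]; congr 1; ring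

lemma cs_outer (n : ℕ) [NeZero n] (a b : ZMod n) (h : ¬ 2 * (sz a + sz b) < n) :
    cs a + cs b ≤ 0 := by
  rw [cs_eq, cs_eq]
  have ha : sz a ≤ n / 2 := ZMod.natAbs_valMinAbs_le a
  have hb : sz b ≤ n / 2 := ZMod.natAbs_valMinAbs_le b
  have hn : (0 : ℝ) < n := by exact_mod_cast NeZero.pos n
  have hpi := Real.pi_pos
  have ha' : 2 * (sz a : ℝ) ≤ n := by exact_mod_cast (by omega : 2 * sz a ≤ n)
  have hb' : 2 * (sz b : ℝ) ≤ n := by exact_mod_cast (by omega : 2 * sz b ≤ n)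
  have hab : (n : ℝ) ≤ 2 * sz a + 2 * sz b := by
    exact_mod_cast (by omega : n ≤ 2 * sz a + 2 * sz b)
  have key : Real.cos (2 * Real.pi * (sz b : ℝ) / n)
      ≤ Real.cos (Real.pi - 2 * Real.pi * (sz a : ℝ) / n) := by
    apply Real.cos_le_cos_of_nonneg_of_le_pi
    · rw [sub_nonneg, div_le_iff₀ hn]; nlinarith
    · rw [div_le_iff₀ hn]; nlinarith
    · rw [sub_le_iff_le_add, ← add_div, le_div_iff₀ hn]; nlinarith
  rw [Real.cos_pi_sub] at key
  linarith

/-- total weight at a frequency -/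
lemma weight_le (n : ℕ) [NeZero n] (a b : ZMod n) (hne : ¬ (a = 0 ∧ b = 0)) :
    2 * (kap (sz b) (sz (b + 2 * a)) + kap (sz b) (sz (b + -2 * a)) +
      kap (sz a) (sz (a + 2 * b)) + kap (sz a) (sz (a + -2 * b)))
      + |(1 + 2 * cs a) * (1 + 2 * cs b)| ≤ 16 := by
  have u1 : cs a ≤ 1 := Real.cos_le_one _
  have u2 : -1 ≤ cs a := Real.neg_one_le_cos _
  have v1 : cs b ≤ 1 := Real.cos_le_one _
  have v2 : -1 ≤ cs b := Real.neg_one_le_cos _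
  by_cases h : 2 * (sz a + sz b) < n
  · have h1 := kap_sum_inner n a b h hne
    have h2 : |(1 + 2 * cs a) * (1 + 2 * cs b)| ≤ 9 := by
      rw [abs_mul]
      have : |1 + 2 * cs a| ≤ 3 := abs_le.2 ⟨by linarith, by linarith⟩
      have : |1 + 2 * cs b| ≤ 3 := abs_le.2 ⟨by linarith, by linarith⟩
      nlinarith [abs_nonneg (1 + 2 * cs a), abs_nonneg (1 + 2 * cs b)]
    linarith
  · have h1 := cs_outer n a b h
    have h2 : |(1 + 2 * cs a) * (1 + 2 * cs b)| ≤ 3 := by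
      rw [abs_le]
      constructor
      · nlinarith [mul_nonneg (by linarith : 0 ≤ 1 + cs a) (by linarith : 0 ≤ 1 + cs b),
          mul_nonneg (by linarith : 0 ≤ 1 - cs a) (by linarith : 0 ≤ 1 - cs b)]
      · nlinarith [sq_nonneg (cs a - cs b)]
    have b1 := kap_le (sz b) (sz (b + 2 * a))
    have b2 := kap_le (sz b) (sz (b + -2 * a))
    have b3 := kap_le (sz a) (sz (a + 2 * b))
    have b4 := kap_le (sz a) (sz (a + -2 * b))
    linarith

end RotorAux

namespace RotorAux

open Finset

section Fourier

variable {n : ℕ} [NeZero n]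

/-- Fourier transform on the torus -/
noncomputable def hat (f : Tor n → ℝ) (x : Tor n) : ℂ :=
  ∑ z : Tor n, (f z : ℂ) * ZMod.stdAddChar (x.1 * z.1 + x.2 * z.2)

lemma char_orth (z w : Tor n) :
    ∑ x : Tor n, (ZMod.stdAddChar (-(x.1 * z.1 + x.2 * z.2)) : ℂ) *
      ZMod.stdAddChar (x.1 * w.1 + x.2 * w.2) = if z = w then (n : ℂ) ^ 2 else 0 := by
  have h1 : ∀ x : Tor n, (ZMod.stdAddChar (-(x.1 * z.1 + x.2 * z.2)) : ℂ) *
      ZMod.stdAddChar (x.1 * w.1 + x.2 * w.2) =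
      ZMod.stdAddChar (x.1 * (w.1 - z.1)) * ZMod.stdAddChar (x.2 * (w.2 - z.2)) := by
    intro x
    rw [← AddChar.map_add_eq_mul, ← AddChar.map_add_eq_mul]
    congr 1; ring
  simp_rw [h1]
  rw [Fintype.sum_prod_type]
  simp_rw [← Finset.mul_sum]
  rw [← Finset.sum_mul, AddChar.sum_mulShift _ (ZMod.isPrimitive_stdAddChar n),
    AddChar.sum_mulShift _ (ZMod.isPrimitive_stdAddChar n)]
  simp only [sub_eq_zero, ZMod.card]
  by_cases h : z = w
  · subst h; simp [pow_two]
  · rw [if_neg h]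
    by_cases h2 : w.1 = z.1
    · have : ¬ w.2 = z.2 := fun h3 => h (Prod.ext h2.symm h3.symm)
      simp [this]
    · simp [h2]

lemma hat_conj (f : Tor n → ℝ) (x : Tor n) :
    (starRingEnd ℂ) (hat f x) =
      ∑ z : Tor n, (f z : ℂ) * ZMod.stdAddChar (-(x.1 * z.1 + x.2 * z.2)) := by
  unfold hat
  rw [map_sum]
  refine Finset.sum_congr rfl fun z _ => ?_
  rw [map_mul, AddChar.map_neg_eq_conj, Complex.conj_ofReal]

lemma parseval (f h : Tor n → ℝ) :
    ∑ x : Tor n, (starRingEnd ℂ) (hat f x) * hat h x = ((n ^ 2 * ∑ z, f z * h z : ℝ) : ℂ) := by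
  calc ∑ x : Tor n, (starRingEnd ℂ) (hat f x) * hat h x
      = ∑ x : Tor n, ∑ z : Tor n, ∑ w : Tor n, (f z : ℂ) * (h w : ℂ) *
        ((ZMod.stdAddChar (-(x.1 * z.1 + x.2 * z.2)) : ℂ) *
          ZMod.stdAddChar (x.1 * w.1 + x.2 * w.2)) := by
        refine Finset.sum_congr rfl fun x _ => ?_
        rw [hat_conj]
        unfold hat
        rw [Finset.sum_mul_sum]
        refine Finset.sum_congr rfl fun z _ => Finset.sum_congr rfl fun w _ => ?_
        ring
    _ = ∑ z : Tor n, ∑ w : Tor n, (f z : ℂ) * (h w : ℂ) * (if z = w then (n : ℂ) ^ 2 else 0) := by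
        rw [Finset.sum_comm]
        refine Finset.sum_congr rfl fun z _ => ?_
        rw [Finset.sum_comm]
        refine Finset.sum_congr rfl fun w _ => ?_
        rw [← Finset.mul_sum, char_orth]
    _ = _ := by
        simp only [mul_ite, mul_zero, Finset.sum_ite_eq, Finset.mem_univ, if_true]
        push_cast
        rw [Finset.mul_sum]
        refine Finset.sum_congr rfl fun w _ => ?_
        ring

lemma parseval_sq (f : Tor n → ℝ) :
    ∑ x : Tor n, ‖hat f x‖ ^ 2 = n ^ 2 * ∑ z, f z ^ 2 := by
  have h := parseval f f
  have h2 : ∀ x, (starRingEnd ℂ) (hat f x) * hat f x = ((‖hat f x‖ ^ 2 : ℝ) : ℂ) := by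
    intro x
    rw [Complex.conj_mul']; push_cast; rfl
  simp_rw [h2] at h
  rw [← Complex.ofReal_sum] at h
  rw [Complex.ofReal_inj.1 h]
  simp_rw [pow_two]

lemma parseval_le (f h : Tor n → ℝ) (B : Tor n → ℝ)
    (hB : ∀ x, 2 * (‖hat f x‖ * ‖hat h x‖) ≤ B x) :
    n ^ 2 * (2 * ∑ z, f z * h z) ≤ ∑ x, B x := by
  have h1 := parseval f h
  have h2 : (n ^ 2 * ∑ z, f z * h z : ℝ) ≤ ∑ x, ‖hat f x‖ * ‖hat h x‖ := by
    calc (n ^ 2 * ∑ z, f z * h z : ℝ) ≤ ‖((n ^ 2 * ∑ z, f z * h z : ℝ) : ℂ)‖ := by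
          rw [Complex.norm_real]; exact le_abs_self _
      _ ≤ ∑ x, ‖(starRingEnd ℂ) (hat f x) * hat h x‖ := by
          rw [← h1]; exact norm_sum_le _ _
      _ = _ := by
          refine Finset.sum_congr rfl fun x _ => ?_
          rw [norm_mul, RCLike.norm_conj]
  have h3 : ∑ x, 2 * (‖hat f x‖ * ‖hat h x‖) ≤ ∑ x, B x := Finset.sum_le_sum fun x _ => hB x
  rw [← Finset.mul_sum] at h3
  linarith

lemma hat_zero (f : Tor n → ℝ) (hf : ∑ z, f z = 0) : hat f (0, 0) = 0 := by
  unfold hat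
  simp only [zero_mul, add_zero, AddChar.map_zero_eq_one, mul_one]
  rw [← Complex.ofReal_sum, hf, Complex.ofReal_zero]

lemma hat_sh1 (h : Tor n → ℝ) (k : ZMod n) (x : Tor n) :
    hat (fun z => h (sh1 n k z)) x = hat h (sh2 n (-k) x) := by
  unfold hat
  rw [← Equiv.sum_comp (sh1 n k) (fun z => (h z : ℂ) *
    ZMod.stdAddChar ((sh2 n (-k) x).1 * z.1 + (sh2 n (-k) x).2 * z.2))]
  refine Finset.sum_congr rfl fun z _ => ?_
  congr 2
  simp only [sh1, sh2, Equiv.coe_fn_mk]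
  ring

lemma hat_sh2 (h : Tor n → ℝ) (k : ZMod n) (x : Tor n) :
    hat (fun z => h (sh2 n k z)) x = hat h (sh1 n (-k) x) := by
  unfold hat
  rw [← Equiv.sum_comp (sh2 n k) (fun z => (h z : ℂ) *
    ZMod.stdAddChar ((sh1 n (-k) x).1 * z.1 + (sh1 n (-k) x).2 * z.2))]
  refine Finset.sum_congr rfl fun z _ => ?_
  congr 2
  simp only [sh1, sh2, Equiv.coe_fn_mk]
  ring

lemma hat_tr (h : Tor n → ℝ) (v : Tor n) (x : Tor n) :
    hat (fun z => h (z + v)) x =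
      hat h x * (ZMod.stdAddChar (-(x.1 * v.1)) * ZMod.stdAddChar (-(x.2 * v.2))) := by
  unfold hat
  rw [← Equiv.sum_comp (Equiv.addRight v) (fun z => (h z : ℂ) *
    ZMod.stdAddChar (x.1 * z.1 + x.2 * z.2)), Finset.sum_mul]
  refine Finset.sum_congr rfl fun z _ => ?_
  rw [mul_assoc, ← AddChar.map_add_eq_mul, ← AddChar.map_add_eq_mul]
  simp only [Equiv.coe_addRight, Prod.fst_add, Prod.snd_add]
  congr 2
  ring

/-- the three shifts -/
def tr (n : ℕ) : Fin 3 → ZMod n := ![0, 1, -1]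

lemma char_tr (a : ZMod n) :
    ∑ i : Fin 3, (ZMod.stdAddChar (-(a * tr n i)) : ℂ) = ((1 + 2 * cs a : ℝ) : ℂ) := by
  simp only [Fin.sum_univ_three, tr, Matrix.cons_val_zero, Matrix.cons_val_one, Matrix.cons_val]
  simp only [mul_zero, neg_zero, AddChar.map_zero_eq_one, mul_one, mul_neg, neg_neg]
  have h1 : (ZMod.stdAddChar a : ℂ) =
      Complex.exp (((2 * Real.pi * (a.valMinAbs : ℝ) / n : ℝ) : ℂ) * Complex.I) := by
    conv_lhs => rw [← ZMod.coe_valMinAbs a]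
    rw [ZMod.stdAddChar_coe]
    congr 1; push_cast; ring
  have h2 : (ZMod.stdAddChar a : ℂ) + ZMod.stdAddChar (-a) = ((2 * cs a : ℝ) : ℂ) := by
    rw [AddChar.map_neg_eq_conj, Complex.add_conj, h1, Complex.exp_ofReal_mul_I_re]
    rfl
  have : (1 : ℂ) + ZMod.stdAddChar (-a) + ZMod.stdAddChar a
    = 1 + (ZMod.stdAddChar a + ZMod.stdAddChar (-a)) := by ring
  rw [this, h2]; push_cast; ring

lemma hat_trs (h : Tor n → ℝ) (x : Tor n) :
    hat (fun z => ∑ i : Fin 3, ∑ j : Fin 3, h (z + (tr n i, tr n j))) x =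
      hat h x * (((1 + 2 * cs x.1) * (1 + 2 * cs x.2) : ℝ) : ℂ) := by
  have h1 : hat (fun z => ∑ i : Fin 3, ∑ j : Fin 3, h (z + (tr n i, tr n j))) x =
      ∑ i : Fin 3, ∑ j : Fin 3, hat (fun z => h (z + (tr n i, tr n j))) x := by
    unfold hat
    simp_rw [Complex.ofReal_sum, Finset.sum_mul]
    rw [Finset.sum_comm]
    refine Finset.sum_congr rfl fun i _ => ?_
    rw [Finset.sum_comm]
  rw [h1]
  simp_rw [hat_tr, ← Finset.mul_sum]
  rw [← Finset.sum_mul, char_tr, char_tr]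
  push_cast; ring

lemma shear1 (F H : Tor n → ℝ) (k : ZMod n) :
    n ^ 2 * (2 * ∑ z, F z * H (sh1 n k z)) ≤
      ∑ x : Tor n, (kap (sz x.2) (sz (x.2 + -k * x.1)) * ‖hat F x‖ ^ 2 +
        kap (sz x.2) (sz (x.2 + k * x.1)) * ‖hat H x‖ ^ 2) := by
  refine (parseval_le F (fun z => H (sh1 n k z)) (fun x =>
    kap (sz x.2) (sz (sh2 n (-k) x).2) * ‖hat F x‖ ^ 2 +
    kap (sz (sh2 n (-k) x).2) (sz x.2) * ‖hat H (sh2 n (-k) x)‖ ^ 2) ?_).trans (le_of_eq ?_)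
  · intro x
    rw [hat_sh1]
    exact amgm _ _ _ _
  · rw [Finset.sum_add_distrib, Finset.sum_add_distrib]
    congr 1
    rw [← Equiv.sum_comp (sh2 n (-k)) (fun x : Tor n =>
      kap (sz x.2) (sz (x.2 + k * x.1)) * ‖hat H x‖ ^ 2)]
    refine Finset.sum_congr rfl fun x _ => ?_
    congr 3
    simp only [sh2, Equiv.coe_fn_mk]
    ring

lemma shear2 (F H : Tor n → ℝ) (k : ZMod n) :
    n ^ 2 * (2 * ∑ z, F z * H (sh2 n k z)) ≤
      ∑ x : Tor n, (kap (sz x.1) (sz (x.1 + -k * x.2)) * ‖hat F x‖ ^ 2 +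
        kap (sz x.1) (sz (x.1 + k * x.2)) * ‖hat H x‖ ^ 2) := by
  refine (parseval_le F (fun z => H (sh2 n k z)) (fun x =>
    kap (sz x.1) (sz (sh1 n (-k) x).1) * ‖hat F x‖ ^ 2 +
    kap (sz (sh1 n (-k) x).1) (sz x.1) * ‖hat H (sh1 n (-k) x)‖ ^ 2) ?_).trans (le_of_eq ?_)
  · intro x
    rw [hat_sh2]
    exact amgm _ _ _ _
  · rw [Finset.sum_add_distrib, Finset.sum_add_distrib]
    congr 1
    rw [← Equiv.sum_comp (sh1 n (-k)) (fun x : Tor n =>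
      kap (sz x.1) (sz (x.1 + k * x.2)) * ‖hat H x‖ ^ 2)]
    refine Finset.sum_congr rfl fun x _ => ?_
    congr 3
    simp only [sh1, Equiv.coe_fn_mk]
    ring

lemma trans_bound (F H : Tor n → ℝ) :
    n ^ 2 * (2 * ∑ z, F z * ∑ i : Fin 3, ∑ j : Fin 3, H (z + (tr n i, tr n j))) ≤
      ∑ x : Tor n, |(1 + 2 * cs x.1) * (1 + 2 * cs x.2)| * (‖hat F x‖ ^ 2 + ‖hat H x‖ ^ 2) := by
  refine parseval_le F _ _ ?_
  intro x
  rw [hat_trs, norm_mul, Complex.norm_real, Real.norm_eq_abs]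
  nlinarith [mul_nonneg (abs_nonneg ((1 + 2 * cs x.1) * (1 + 2 * cs x.2)))
    (sq_nonneg (‖hat F x‖ - ‖hat H x‖))]

theorem margulis (F H : Tor n → ℝ) (hF : ∑ z, F z = 0) (hH : ∑ z, H z = 0) :
    2 * (2 * (∑ z, F z * H (sh1 n 2 z) + ∑ z, F z * H (sh1 n (-2) z) +
      ∑ z, F z * H (sh2 n 2 z) + ∑ z, F z * H (sh2 n (-2) z)) +
      ∑ z, F z * ∑ i : Fin 3, ∑ j : Fin 3, H (z + (tr n i, tr n j)))
      ≤ 16 * (∑ z, F z ^ 2 + ∑ z, H z ^ 2) := by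
  have s1 := shear1 F H 2
  have s2 := shear1 F H (-2)
  have s3 := shear2 F H 2
  have s4 := shear2 F H (-2)
  have s5 := trans_bound F H
  rw [neg_neg] at s2 s4
  have p1 := parseval_sq F
  have p2 := parseval_sq H
  have key : ∀ x : Tor n,
      2 * (kap (sz x.2) (sz (x.2 + -2 * x.1)) * ‖hat F x‖ ^ 2 +
        kap (sz x.2) (sz (x.2 + 2 * x.1)) * ‖hat H x‖ ^ 2) +
      2 * (kap (sz x.2) (sz (x.2 + 2 * x.1)) * ‖hat F x‖ ^ 2 +
        kap (sz x.2) (sz (x.2 + -2 * x.1)) * ‖hat H x‖ ^ 2) +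
      2 * (kap (sz x.1) (sz (x.1 + -2 * x.2)) * ‖hat F x‖ ^ 2 +
        kap (sz x.1) (sz (x.1 + 2 * x.2)) * ‖hat H x‖ ^ 2) +
      2 * (kap (sz x.1) (sz (x.1 + 2 * x.2)) * ‖hat F x‖ ^ 2 +
        kap (sz x.1) (sz (x.1 + -2 * x.2)) * ‖hat H x‖ ^ 2) +
      |(1 + 2 * cs x.1) * (1 + 2 * cs x.2)| * (‖hat F x‖ ^ 2 + ‖hat H x‖ ^ 2) ≤
      16 * ‖hat F x‖ ^ 2 + 16 * ‖hat H x‖ ^ 2 := by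
    intro x
    by_cases hx : x.1 = 0 ∧ x.2 = 0
    · have : x = (0, 0) := Prod.ext hx.1 hx.2
      rw [this, hat_zero F hF, hat_zero H hH]
      simp
    · have w := weight_le n x.1 x.2 hx
      have := mul_le_mul_of_nonneg_right w
        (by positivity : 0 ≤ ‖hat F x‖ ^ 2 + ‖hat H x‖ ^ 2)
      linarith
  have ks := Finset.sum_le_sum fun x (_ : x ∈ (Finset.univ : Finset (Tor n))) => key x
  rw [Finset.sum_add_distrib, Finset.sum_add_distrib, Finset.sum_add_distrib,
    Finset.sum_add_distrib, Finset.sum_add_distrib, ← Finset.mul_sum, ← Finset.mul_sum,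
    ← Finset.mul_sum, ← Finset.mul_sum, ← Finset.mul_sum, ← Finset.mul_sum, p1, p2] at ks
  have hn : (0 : ℝ) < (n : ℝ) ^ 2 := by
    have : (0 : ℝ) < n := by exact_mod_cast NeZero.pos n
    positivity
  refine le_of_mul_le_mul_left ?_ hn
  linarith

end Fourier

end RotorAux

namespace RotorAux

open Finset

instance fact17 : Fact (Nat.Prime 17) := ⟨by norm_num⟩

lemma refl_sum (c : ZMod 17) (y : ZMod 17 → ℝ) : ∑ u, y (c - u) = ∑ v, y v :=
  Equiv.sum_comp (Equiv.subLeft c) y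

lemma pair_sum (l j j' : ZMod 17) (h : j ≠ j') (p q : ZMod 17 → ℝ) :
    ∑ i : ZMod 17, ∑ u : ZMod 17, p (l - i * j - u) * q (l - i * j' - u)
      = (∑ v, p v) * ∑ v, q v := by
  rw [Finset.sum_mul_sum, ← Fintype.sum_prod_type', ← Fintype.sum_prod_type']
  refine Function.Bijective.sum_comp (e := fun x : ZMod 17 × ZMod 17 =>
    (l - x.1 * j - x.2, l - x.1 * j' - x.2)) ?_ (fun x => p x.1 * q x.2)
  rw [← Finite.injective_iff_bijective]
  rintro ⟨i, u⟩ ⟨i', u'⟩ he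
  simp only [Prod.mk.injEq] at he
  obtain ⟨h1, h2⟩ := he
  have h3 : (i - i') * (j - j') = 0 := by linear_combination h2 - h1
  have h4 : i = i' := by
    rcases mul_eq_zero.1 h3 with h5 | h5
    · exact sub_eq_zero.1 h5
    · exact absurd (sub_eq_zero.1 h5) h
  subst h4
  have h5 : u = u' := by linear_combination -h1
  rw [h5]

lemma sumS_sq (l : ZMod 17) (y : ZMod 17 → ZMod 17 → ℝ) :
    ∑ i : ZMod 17, ∑ u : ZMod 17, (∑ j, y j (l - i * j - u)) ^ 2
      = 17 * ∑ j, ∑ v, y j v ^ 2 + (∑ j, ∑ v, y j v) ^ 2 - ∑ j, (∑ v, y j v) ^ 2 := by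
  have h1 : ∀ j j' : ZMod 17,
      ∑ i : ZMod 17, ∑ u : ZMod 17, y j (l - i * j - u) * y j' (l - i * j' - u)
      = (∑ v, y j v) * (∑ v, y j' v) +
        if j = j' then 17 * ∑ v, y j v ^ 2 - (∑ v, y j v) ^ 2 else 0 := by
    intro j j'
    by_cases h : j = j'
    · subst h
      rw [if_pos rfl]
      have : ∀ i : ZMod 17, ∑ u : ZMod 17, y j (l - i * j - u) * y j (l - i * j - u)
          = ∑ v, y j v ^ 2 := by
        intro i
        rw [← refl_sum (l - i * j) (fun v => y j v ^ 2)]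
        simp_rw [pow_two]
      simp_rw [this]
      rw [Finset.sum_const, Finset.card_univ, ZMod.card, nsmul_eq_mul]
      push_cast; ring
    · rw [if_neg h, add_zero]
      exact pair_sum l j j' h _ _
  calc ∑ i : ZMod 17, ∑ u : ZMod 17, (∑ j, y j (l - i * j - u)) ^ 2
      = ∑ i : ZMod 17, ∑ u : ZMod 17, ∑ j, ∑ j', y j (l - i * j - u) * y j' (l - i * j' - u) := by
        simp_rw [pow_two, Finset.sum_mul_sum]
    _ = ∑ j, ∑ j', ∑ i : ZMod 17, ∑ u : ZMod 17,
          y j (l - i * j - u) * y j' (l - i * j' - u) := by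
        have e1 : ∀ i : ZMod 17, ∑ u : ZMod 17, ∑ j, ∑ j',
            y j (l - i * j - u) * y j' (l - i * j' - u) =
            ∑ j, ∑ j', ∑ u : ZMod 17, y j (l - i * j - u) * y j' (l - i * j' - u) := by
          intro i
          rw [Finset.sum_comm]
          exact Finset.sum_congr rfl fun j _ => Finset.sum_comm
        simp_rw [e1]
        rw [Finset.sum_comm]
        exact Finset.sum_congr rfl fun j _ => Finset.sum_comm
    _ = _ := by
        simp_rw [h1, Finset.sum_add_distrib]
        simp only [Finset.sum_ite_eq, Finset.mem_univ, if_true]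
        rw [Finset.sum_sub_distrib, ← Finset.mul_sum, ← Finset.sum_mul_sum]
        ring

lemma sumS (l : ZMod 17) (y : ZMod 17 → ZMod 17 → ℝ) :
    ∑ i : ZMod 17, ∑ u : ZMod 17, ∑ j, y j (l - i * j - u) = 17 * ∑ j, ∑ v, y j v := by
  have : ∀ i : ZMod 17, ∑ u : ZMod 17, ∑ j, y j (l - i * j - u) = ∑ j, ∑ v, y j v := by
    intro i
    rw [Finset.sum_comm]
    exact Finset.sum_congr rfl fun j _ => refl_sum _ _
  simp_rw [this]
  rw [Finset.sum_const, Finset.card_univ, ZMod.card, nsmul_eq_mul]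
  norm_num

lemma K_lemma (l : ZMod 17) (x y : ZMod 17 → ZMod 17 → ℝ) :
    2 * ∑ i, ∑ u, x i u * ∑ j, y j (l - i * j - u) ≤
      2 / 17 * ((∑ i, ∑ u, x i u) * ∑ j, ∑ v, y j v) +
      5 * ((∑ i, ∑ u, x i u ^ 2 - (∑ i, ∑ u, x i u) ^ 2 / 289) +
        (∑ i, ∑ u, y i u ^ 2 - (∑ i, ∑ u, y i u) ^ 2 / 289)) := by
  have h1 := sumS_sq l y
  have h2 := sumS l y
  set S : ZMod 17 → ZMod 17 → ℝ := fun i u => ∑ j, y j (l - i * j - u) with hS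
  change ∑ i, ∑ u, S i u ^ 2 = _ at h1
  change ∑ i, ∑ u, S i u = _ at h2
  change 2 * ∑ i, ∑ u, x i u * S i u ≤ _
  have h3 : (∑ j, ∑ v, y j v) ^ 2 ≤ 17 * ∑ j, (∑ v, y j v) ^ 2 := by
    have := sq_sum_le_card_mul_sum_sq (s := (Finset.univ : Finset (ZMod 17)))
      (f := fun j => ∑ v, y j v)
    rw [Finset.card_univ, ZMod.card] at this
    exact_mod_cast this
  generalize (∑ j, ∑ v, y j v) = Y at *
  generalize hX : (∑ j, ∑ v, x j v) = X at *
  generalize (∑ j, (∑ v, y j v) ^ 2) = m2 at *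
  generalize (∑ j, ∑ v, y j v ^ 2) = y2 at *
  generalize hx2 : (∑ j, ∑ v, x j v ^ 2) = x2 at *
  have key : ∀ i u, 2 * (x i u * S i u) ≤ 2 * (Y / 17) * x i u + 2 * (X / 289) * S i u
      - 2 * (X / 289) * (Y / 17) + 5 * (x i u ^ 2 - 2 * (X / 289) * x i u + (X / 289) ^ 2)
      + 1 / 5 * (S i u ^ 2 - 2 * (Y / 17) * S i u + (Y / 17) ^ 2) := by
    intro i u
    nlinarith [sq_nonneg (5 * (x i u - X / 289) - (S i u - Y / 17))]
  have ks := Finset.sum_le_sum fun i (_ : i ∈ (Finset.univ : Finset (ZMod 17))) =>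
    Finset.sum_le_sum fun u (_ : u ∈ (Finset.univ : Finset (ZMod 17))) => key i u
  simp only [Finset.sum_add_distrib, Finset.sum_sub_distrib, ← Finset.mul_sum,
    Finset.sum_const, Finset.card_univ, ZMod.card, nsmul_eq_mul, hX, hx2, h1, h2] at ks
  have h4 : 0 ≤ 17 * y2 + Y ^ 2 - m2 - Y ^ 2 := by
    have : 0 ≤ ∑ i, ∑ u, (S i u - Y / 17) ^ 2 := by positivity
    simp only [sub_sq, mul_assoc, Finset.sum_add_distrib, Finset.sum_sub_distrib,
      ← Finset.mul_sum, ← Finset.sum_mul,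
      Finset.sum_const, Finset.card_univ, ZMod.card, nsmul_eq_mul, h1, h2] at this
    push_cast at this
    nlinarith
  push_cast at ks
  nlinarith

lemma bip_spec {Z : Type*} [Fintype Z] [Nonempty Z] (g : ZMod 17 → Equiv.Perm Z)
    (hg : ∀ F H : Z → ℝ, ∑ z, F z = 0 → ∑ z, H z = 0 →
      2 * ∑ l, ∑ z, F z * H (g l z) ≤ 16 * (∑ z, F z ^ 2 + ∑ z, H z ^ 2))
    (fA fB : Z → ZMod 17 → ZMod 17 → ℝ)
    (h0 : ∑ z, ∑ i, ∑ u, fA z i u + ∑ z, ∑ i, ∑ u, fB z i u = 0) :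
    2 * ∑ z, ∑ i, ∑ u, ∑ j, ∑ v, fA z i u * fB (g (i * j + u + v) z) j v ≤
      272 * (∑ z, ∑ i, ∑ u, fA z i u ^ 2 + ∑ z, ∑ i, ∑ u, fB z i u ^ 2) := by
  have r1 : ∑ z, ∑ i, ∑ u, ∑ j, ∑ v, fA z i u * fB (g (i * j + u + v) z) j v =
      ∑ l, ∑ z, ∑ i, ∑ u, fA z i u * ∑ j, fB (g l z) j (l - i * j - u) := by
    symm
    rw [Finset.sum_comm]
    refine Finset.sum_congr rfl fun z _ => ?_
    rw [Finset.sum_comm]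
    refine Finset.sum_congr rfl fun i _ => ?_
    rw [Finset.sum_comm]
    refine Finset.sum_congr rfl fun u _ => ?_
    rw [← Finset.mul_sum]
    simp_rw [← Finset.mul_sum]
    rw [Finset.sum_comm]
    congr 1
    refine Finset.sum_congr rfl fun j _ => ?_
    rw [← Equiv.sum_comp (Equiv.addLeft (i * j + u))
      (fun l => fB (g l z) j (l - i * j - u))]
    refine Finset.sum_congr rfl fun v _ => ?_
    simp only [Equiv.coe_addLeft]
    congr 1; ring
  rw [r1]
  have r2 := Finset.sum_le_sum fun l (_ : l ∈ (Finset.univ : Finset (ZMod 17))) =>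
    Finset.sum_le_sum fun z (_ : z ∈ (Finset.univ : Finset Z)) => K_lemma l (fA z) (fB (g l z))
  set SA : Z → ℝ := fun z => ∑ i, ∑ u, fA z i u with hSA
  set SB : Z → ℝ := fun z => ∑ i, ∑ u, fB z i u with hSB
  set QA : Z → ℝ := fun z => ∑ i, ∑ u, fA z i u ^ 2 with hQA
  set QB : Z → ℝ := fun z => ∑ i, ∑ u, fB z i u ^ 2 with hQB
  have cs : ∀ f : ZMod 17 → ZMod 17 → ℝ, (∑ i, ∑ u, f i u) ^ 2 ≤ 289 * ∑ i, ∑ u, f i u ^ 2 := by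
    intro f
    rw [← Fintype.sum_prod_type', ← Fintype.sum_prod_type' (f := fun i u => f i u ^ 2)]
    have := sq_sum_le_card_mul_sum_sq (s := (Finset.univ : Finset (ZMod 17 × ZMod 17)))
      (f := fun p => f p.1 p.2)
    rw [Finset.card_univ, Fintype.card_prod, ZMod.card] at this
    push_cast at this
    linarith
  have r3 : 2 * ∑ l, ∑ z, ∑ i, ∑ u, fA z i u * ∑ j, fB (g l z) j (l - i * j - u) ≤
      ∑ l, ∑ z, (2 / 17 * (SA z * SB (g l z)) + 5 * ((QA z - SA z ^ 2 / 289) +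
        (QB (g l z) - SB (g l z) ^ 2 / 289))) := by
    refine le_trans (le_of_eq ?_) r2
    simp_rw [Finset.mul_sum]
  refine r3.trans ?_
  have r4 : ∀ l, ∑ z, (QB (g l z) - SB (g l z) ^ 2 / 289) = ∑ z, (QB z - SB z ^ 2 / 289) :=
    fun l => Equiv.sum_comp (g l) (fun z => QB z - SB z ^ 2 / 289)
  simp only [Finset.sum_add_distrib, ← Finset.mul_sum, r4]
  simp only [Finset.sum_sub_distrib, ← Finset.sum_div, Finset.sum_const, Finset.card_univ,
    ZMod.card, nsmul_eq_mul]
  -- mean decomposition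
  have hN : (0 : ℝ) < Fintype.card Z := by exact_mod_cast Fintype.card_pos
  obtain ⟨m, hm⟩ : ∃ m : ℝ, Fintype.card Z * m = ∑ z, SA z :=
    ⟨(∑ z, SA z) / Fintype.card Z, by field_simp⟩
  have hm' : Fintype.card Z * (-m) = ∑ z, SB z := by
    have : ∑ z, SA z + ∑ z, SB z = 0 := h0
    linarith
  have gg := hg (fun z => SA z - m) (fun z => SB z + m)
    (by simp [Finset.sum_sub_distrib, ← hm]) (by simp [Finset.sum_add_distrib, ← hm'])
  have g1 : ∑ l, ∑ z, (SA z - m) * (SB (g l z) + m) =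
      ∑ l, ∑ z, SA z * SB (g l z) + 17 * (Fintype.card Z * m ^ 2) := by
    have : ∀ l, ∑ z, (SA z - m) * (SB (g l z) + m) =
        ∑ z, SA z * SB (g l z) + Fintype.card Z * m ^ 2 := by
      intro l
      have e : ∑ z, SB (g l z) = ∑ z, SB z := Equiv.sum_comp (g l) SB
      have : ∀ z, (SA z - m) * (SB (g l z) + m) =
        SA z * SB (g l z) + m * SA z - m * SB (g l z) - m ^ 2 := fun z => by ring
      simp only [this, Finset.sum_add_distrib, Finset.sum_sub_distrib, ← Finset.mul_sum, e,
        ← hm, ← hm', Finset.sum_const, Finset.card_univ, nsmul_eq_mul]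
      ring
    simp only [this, Finset.sum_add_distrib, Finset.sum_const, Finset.card_univ, ZMod.card,
      nsmul_eq_mul]
    push_cast; ring
  have g2 : ∑ z, (SA z - m) ^ 2 = ∑ z, SA z ^ 2 - Fintype.card Z * m ^ 2 := by
    have : ∀ z, (SA z - m) ^ 2 = SA z ^ 2 - 2 * m * SA z + m ^ 2 := fun z => by ring
    simp only [this, Finset.sum_add_distrib, Finset.sum_sub_distrib, ← Finset.mul_sum,
        ← hm, Finset.sum_const, Finset.card_univ, nsmul_eq_mul]
    ring
  have g3 : ∑ z, (SB z + m) ^ 2 = ∑ z, SB z ^ 2 - Fintype.card Z * m ^ 2 := by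
    have : ∀ z, (SB z + m) ^ 2 = SB z ^ 2 + 2 * m * SB z + m ^ 2 := fun z => by ring
    simp only [this, Finset.sum_add_distrib, ← Finset.mul_sum,
        ← hm', Finset.sum_const, Finset.card_univ, nsmul_eq_mul]
    ring
  rw [g1, g2, g3] at gg
  have q1 : ∑ z, SA z ^ 2 ≤ 289 * ∑ z, QA z := by
    rw [Finset.mul_sum]; exact Finset.sum_le_sum fun z _ => cs (fA z)
  have q2 : ∑ z, SB z ^ 2 ≤ 289 * ∑ z, QB z := by
    rw [Finset.mul_sum]; exact Finset.sum_le_sum fun z _ => cs (fB z)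
  have q3 : 0 ≤ Fintype.card Z * m ^ 2 := by positivity
  push_cast
  linarith

end RotorAux

namespace RotorAux

open Finset

/-- one side of the lifted graph -/
abbrev Side (Z : Type) : Type := Z × ZMod 17 × ZMod 17

/-- the lifted bipartite graph -/
def liftGraph {Z : Type} (g : ZMod 17 → Equiv.Perm Z) : SimpleGraph (Side Z ⊕ Side Z) where
  Adj x y := match x, y with
    | Sum.inl p, Sum.inr q => q.1 = g (p.2.1 * q.2.1 + p.2.2 + q.2.2) p.1
    | Sum.inr q, Sum.inl p => q.1 = g (p.2.1 * q.2.1 + p.2.2 + q.2.2) p.1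
    | _, _ => False
  symm := ⟨by
    rintro (p | p) (q | q) h
    · exact h
    · exact h
    · exact h
    · exact h⟩
  loopless := ⟨by
    rintro (p | p) h
    · exact h
    · exact h⟩

lemma card_K : Fintype.card (ZMod 17 × ZMod 17) = 289 := by
  rw [Fintype.card_prod, ZMod.card]

open Classical in
lemma lift_degree {Z : Type} [Fintype Z] (g : ZMod 17 → Equiv.Perm Z) (x : Side Z ⊕ Side Z) :
    (liftGraph g).degree x = 289 := by
  rcases x with p | q
  · have : (liftGraph g).neighborFinset (Sum.inl p) =
        (Finset.univ : Finset (ZMod 17 × ZMod 17)).image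
          (fun b => (Sum.inr (g (p.2.1 * b.1 + p.2.2 + b.2) p.1, b) : Side Z ⊕ Side Z)) := by
      ext y
      rw [SimpleGraph.mem_neighborFinset, Finset.mem_image]
      rcases y with y | y
      · simp [liftGraph]
      · constructor
        · intro h
          exact ⟨y.2, Finset.mem_univ _, by
            have h' : y.1 = g (p.2.1 * y.2.1 + p.2.2 + y.2.2) p.1 := h
            rw [← h']⟩
        · rintro ⟨b, _, hb⟩
          have := Sum.inr_injective hb
          rw [← this]
          exact rfl
    rw [← SimpleGraph.card_neighborFinset_eq_degree, this, Finset.card_image_of_injective,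
      Finset.card_univ, card_K]
    intro b b' h
    exact (Prod.ext_iff.1 (Sum.inr_injective h)).2
  · have : (liftGraph g).neighborFinset (Sum.inr q) =
        (Finset.univ : Finset (ZMod 17 × ZMod 17)).image
          (fun a => (Sum.inl ((g (a.1 * q.2.1 + a.2 + q.2.2)).symm q.1, a) : Side Z ⊕ Side Z)) := by
      ext y
      rw [SimpleGraph.mem_neighborFinset, Finset.mem_image]
      rcases y with y | y
      · constructor
        · intro h
          exact ⟨y.2, Finset.mem_univ _, by
            have h' : q.1 = g (y.2.1 * q.2.1 + y.2.2 + q.2.2) y.1 := h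
            rw [h', Equiv.symm_apply_apply]⟩
        · rintro ⟨b, _, hb⟩
          have := Sum.inl_injective hb
          rw [← this]
          change q.1 = g (b.1 * q.2.1 + b.2 + q.2.2) ((g (b.1 * q.2.1 + b.2 + q.2.2)).symm q.1)
          rw [Equiv.apply_symm_apply]
      · simp [liftGraph]
    rw [← SimpleGraph.card_neighborFinset_eq_degree, this, Finset.card_image_of_injective,
      Finset.card_univ, card_K]
    intro b b' h
    exact (Prod.ext_iff.1 (Sum.inl_injective h)).2

open Classical in
lemma cut_card {Z : Type} [Fintype Z] (g : ZMod 17 → Equiv.Perm Z)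
    (X : Finset (Side Z ⊕ Side Z)) (f : Side Z ⊕ Side Z → ℝ)
    (hf : ∀ x y, (f x - f y) ^ 2 = if (x ∈ X ↔ y ∈ X) then 0 else 1) :
    ∑ z, ∑ i, ∑ u, ∑ j, ∑ v, (f (Sum.inl (z, i, u)) -
      f (Sum.inr (g (i * j + u + v) z, j, v))) ^ 2 ≤
      (((X ×ˢ Xᶜ).filter fun p => (liftGraph g).Adj p.1 p.2).card : ℝ) := by
  simp only [hf]
  let A : Z × ZMod 17 × ZMod 17 × ZMod 17 × ZMod 17 → Side Z ⊕ Side Z :=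
    fun t => Sum.inl (t.1, t.2.1, t.2.2.1)
  let B : Z × ZMod 17 × ZMod 17 × ZMod 17 × ZMod 17 → Side Z ⊕ Side Z :=
    fun t => Sum.inr (g (t.2.1 * t.2.2.2.1 + t.2.2.1 + t.2.2.2.2) t.1, t.2.2.2.1, t.2.2.2.2)
  have h1 : ∑ z, ∑ i, ∑ u, ∑ j, ∑ v,
      (if ((Sum.inl (z, i, u) : Side Z ⊕ Side Z) ∈ X ↔
        (Sum.inr (g (i * j + u + v) z, j, v) : Side Z ⊕ Side Z) ∈ X) then (0 : ℝ) else 1) =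
      ∑ t, if (A t ∈ X ↔ B t ∈ X) then (0 : ℝ) else 1 := by
    simp only [Fintype.sum_prod_type, A, B]
  rw [h1]
  have h2 : (∑ t, if (A t ∈ X ↔ B t ∈ X) then (0 : ℝ) else 1) =
      ((Finset.univ.filter fun t => ¬ (A t ∈ X ↔ B t ∈ X)).card : ℝ) := by
    rw [Finset.card_filter]
    push_cast
    refine Finset.sum_congr rfl fun t _ => ?_
    by_cases h : (A t ∈ X ↔ B t ∈ X) <;> simp [h]
  rw [h2]
  have hinj : ∀ t t', A t = A t' → B t = B t' → t = t' := by
    rintro ⟨z, i, u, j, v⟩ ⟨z', i', u', j', v'⟩ ha hb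
    have ha' := Sum.inl_injective ha
    have hb' := Sum.inr_injective hb
    simp only [Prod.mk.injEq] at ha' hb' ⊢
    exact ⟨ha'.1, ha'.2.1, ha'.2.2, hb'.2.1, hb'.2.2⟩
  have hadj : ∀ t, (liftGraph g).Adj (A t) (B t) := fun t => rfl
  have hne : ∀ t t', A t ≠ B t' := fun t t' h => by cases h
  refine Nat.cast_le.2 ?_
  refine Finset.card_le_card_of_injOn (fun t => if A t ∈ X then (A t, B t) else (B t, A t)) ?_ ?_
  · intro t ht
    have ht' : ¬ (A t ∈ X ↔ B t ∈ X) := by simpa using ht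
    simp only [Finset.coe_filter, Set.mem_ofPred_eq, Finset.mem_product, Finset.mem_compl]
    by_cases h : A t ∈ X
    · rw [if_pos h]
      exact ⟨⟨h, fun h' => ht' (iff_of_true h h')⟩, hadj t⟩
    · rw [if_neg h]
      exact ⟨⟨by by_contra h'; exact ht' (iff_of_false h h'), h⟩, (hadj t).symm⟩
  · intro t _ t' _ h
    simp only at h
    by_cases h1 : A t ∈ X <;> by_cases h2 : A t' ∈ X
    · rw [if_pos h1, if_pos h2] at h
      exact hinj _ _ (Prod.ext_iff.1 h).1 (Prod.ext_iff.1 h).2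
    · rw [if_pos h1, if_neg h2] at h
      exact absurd (Prod.ext_iff.1 h).1 (hne _ _)
    · rw [if_neg h1, if_pos h2] at h
      exact absurd (Prod.ext_iff.1 h).1.symm (hne _ _)
    · rw [if_neg h1, if_neg h2] at h
      exact hinj _ _ (Prod.ext_iff.1 h).2 (Prod.ext_iff.1 h).1

open Classical in
lemma lift_expansion {Z : Type} [Fintype Z] [Nonempty Z] (g : ZMod 17 → Equiv.Perm Z)
    (hg : ∀ F H : Z → ℝ, ∑ z, F z = 0 → ∑ z, H z = 0 →
      2 * ∑ l, ∑ z, F z * H (g l z) ≤ 16 * (∑ z, F z ^ 2 + ∑ z, H z ^ 2))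
    (X : Finset (Side Z ⊕ Side Z)) (hX : 2 * X.card ≤ Fintype.card (Side Z ⊕ Side Z)) :
    ((145 : ℕ) : ℝ) / 20 * (X.card : ℝ) ≤
      (((X ×ˢ Xᶜ).filter fun p => (liftGraph g).Adj p.1 p.2).card : ℝ) := by
  set N : ℝ := (Fintype.card (Side Z ⊕ Side Z) : ℝ) with hN
  have hNpos : 0 < N := by
    have : Nonempty (Side Z) := ⟨(Classical.arbitrary Z, 0, 0)⟩
    rw [hN]; exact_mod_cast Fintype.card_pos
  set δ : ℝ := (X.card : ℝ) / N with hδ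
  have hδN : N * δ = X.card := by rw [hδ]; field_simp
  have hδ2 : 2 * δ ≤ 1 := by
    rw [hδ, ← mul_div_assoc, div_le_one hNpos, hN]; exact_mod_cast hX
  let f : Side Z ⊕ Side Z → ℝ := fun x => (if x ∈ X then 1 else 0) - δ
  have hcut := cut_card g X f (by
    intro x y
    by_cases h1 : x ∈ X <;> by_cases h2 : y ∈ X <;>
      simp only [f, h1, h2, if_true, if_false, iff_self, iff_true, iff_false, not_true] <;> ring)
  refine le_trans ?_ hcut
  have hsum : ∑ x, f x = 0 := by
    simp only [f, Finset.sum_sub_distrib, Finset.sum_ite_mem, Finset.univ_inter,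
      Finset.sum_const, Finset.card_univ, nsmul_eq_mul, mul_one]
    rw [← hN, hδN]; ring
  have hsq : ∑ x, f x ^ 2 = X.card - X.card * δ := by
    have : ∀ x, f x ^ 2 = (1 - 2 * δ) * (if x ∈ X then 1 else 0) + δ ^ 2 := by
      intro x; by_cases h : x ∈ X <;> simp [f, h]; ring
    simp only [this, Finset.sum_add_distrib, ← Finset.mul_sum, Finset.sum_ite_mem,
      Finset.univ_inter, Finset.sum_const, Finset.card_univ, nsmul_eq_mul, mul_one]
    rw [← hN, pow_two, ← mul_assoc, hδN]; ring
  rw [Fintype.sum_sum_type] at hsum hsq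
  simp only [Fintype.sum_prod_type] at hsum hsq
  have spec := bip_spec g hg (fun z i u => f (Sum.inl (z, i, u)))
    (fun z i u => f (Sum.inr (z, i, u))) hsum
  rw [hsq] at spec
  have e0 : ∀ z i u j v, (f (Sum.inl (z, i, u)) - f (Sum.inr (g (i * j + u + v) z, j, v))) ^ 2 =
      f (Sum.inl (z, i, u)) ^ 2 + f (Sum.inr (g (i * j + u + v) z, j, v)) ^ 2
      - 2 * (f (Sum.inl (z, i, u)) * f (Sum.inr (g (i * j + u + v) z, j, v))) := by
    intros; ring
  have e1 : ∑ z, ∑ i, ∑ u, ∑ j, ∑ v, f (Sum.inr (g (i * j + u + v) z, j, v)) ^ 2 =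
      289 * ∑ z, ∑ j, ∑ v, f (Sum.inr (z, j, v)) ^ 2 := by
    calc ∑ z, ∑ i, ∑ u, ∑ j, ∑ v, f (Sum.inr (g (i * j + u + v) z, j, v)) ^ 2
        = ∑ z, ∑ a : ZMod 17 × ZMod 17, ∑ b : ZMod 17 × ZMod 17,
            f (Sum.inr (g (a.1 * b.1 + a.2 + b.2) z, b.1, b.2)) ^ 2 := by
          simp only [Fintype.sum_prod_type]
      _ = ∑ a : ZMod 17 × ZMod 17, ∑ b : ZMod 17 × ZMod 17, ∑ z,
            f (Sum.inr (g (a.1 * b.1 + a.2 + b.2) z, b.1, b.2)) ^ 2 := by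
          rw [Finset.sum_comm]
          exact Finset.sum_congr rfl fun a _ => Finset.sum_comm
      _ = ∑ a : ZMod 17 × ZMod 17, ∑ b : ZMod 17 × ZMod 17, ∑ z,
            f (Sum.inr (z, b.1, b.2)) ^ 2 := by
          refine Finset.sum_congr rfl fun a _ => Finset.sum_congr rfl fun b _ => ?_
          exact Equiv.sum_comp (g (a.1 * b.1 + a.2 + b.2))
            (fun z => f (Sum.inr (z, b.1, b.2)) ^ 2)
      _ = _ := by
          rw [Finset.sum_const, Finset.card_univ, card_K, Finset.sum_comm, nsmul_eq_mul]
          simp only [Fintype.sum_prod_type]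
          push_cast; rfl
  have e2 : ∑ z : Z, ∑ i : ZMod 17, ∑ u : ZMod 17, ∑ _j : ZMod 17, ∑ _v : ZMod 17,
      f (Sum.inl (z, i, u)) ^ 2 = 289 * ∑ z, ∑ j, ∑ v, f (Sum.inl (z, j, v)) ^ 2 := by
    simp only [Finset.sum_const, Finset.card_univ, ZMod.card, nsmul_eq_mul, ← Finset.mul_sum]
    push_cast; ring
  simp only [e0, Finset.sum_add_distrib, Finset.sum_sub_distrib]
  rw [e1, e2]
  simp only [← Finset.mul_sum] at spec ⊢
  have hc : (0 : ℝ) ≤ X.card := Nat.cast_nonneg _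
  have : (X.card : ℝ) * δ ≤ X.card * (1 / 2) := mul_le_mul_of_nonneg_left (by linarith) hc
  push_cast
  linarith

/-- generators -/
def gen' (n : ℕ) : Fin 8 ⊕ Fin 3 × Fin 3 → Equiv.Perm (Tor n)
  | Sum.inl i => ![sh1 n 2, sh1 n 2, sh1 n (-2), sh1 n (-2), sh2 n 2, sh2 n 2,
      sh2 n (-2), sh2 n (-2)] i
  | Sum.inr p => Equiv.addRight (tr n p.1, tr n p.2)

/-- labels -/
noncomputable def lab : ZMod 17 ≃ Fin 8 ⊕ Fin 3 × Fin 3 :=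
  Fintype.equivOfCardEq (by simp [ZMod.card])

lemma gen_spec (n : ℕ) [NeZero n] (F H : Tor n → ℝ) (hF : ∑ z, F z = 0) (hH : ∑ z, H z = 0) :
    2 * ∑ l, ∑ z, F z * H (gen' n (lab l) z) ≤ 16 * (∑ z, F z ^ 2 + ∑ z, H z ^ 2) := by
  rw [Equiv.sum_comp lab (fun l => ∑ z, F z * H (gen' n l z)), Fintype.sum_sum_type]
  have h := margulis F H hF hH
  have h1 : ∑ p : Fin 3 × Fin 3, ∑ z, F z * H (gen' n (Sum.inr p) z) =
      ∑ z, F z * ∑ i : Fin 3, ∑ j : Fin 3, H (z + (tr n i, tr n j)) := by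
    rw [Finset.sum_comm]
    refine Finset.sum_congr rfl fun z _ => ?_
    rw [← Finset.mul_sum, Fintype.sum_prod_type]
    rfl
  rw [h1]
  have h2 : ∑ i : Fin 8, ∑ z, F z * H (gen' n (Sum.inl i) z) =
      2 * (∑ z, F z * H (sh1 n 2 z) + ∑ z, F z * H (sh1 n (-2) z) +
      ∑ z, F z * H (sh2 n 2 z) + ∑ z, F z * H (sh2 n (-2) z)) := by
    rw [Fin.sum_univ_eight]
    change ∑ z, F z * H (sh1 n 2 z) + ∑ z, F z * H (sh1 n 2 z) + ∑ z, F z * H (sh1 n (-2) z) +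
      ∑ z, F z * H (sh1 n (-2) z) + ∑ z, F z * H (sh2 n 2 z) + ∑ z, F z * H (sh2 n 2 z) +
      ∑ z, F z * H (sh2 n (-2) z) + ∑ z, F z * H (sh2 n (-2) z) = _
    ring
  rw [h2]
  exact h

end RotorAux


/-- There exist a constant integer `d ≥ 10`, a constant `c > 0`, and an
infinite family of finite connected simple graphs `G = (V, E)` with `|V| → ∞`, minimum
degree at least `d`, maximum degree at most `2d`, and edge expansion
`|E(X, V∖X)| ≥ (d/20)·|X|` for every `X ⊆ V` with `1 ≤ |X| ≤ |V|/2`, such that for each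
graph in the family there are a rotor configuration (with permutation rotor sequences)
and a starting vertex for which the rotor walk needs at least `c·|V|·log|V|` steps to
visit every vertex; in particular `ṼC(G) ≥ c·|V|·log|V|` for these graphs. -/
theorem exists_expander_family_detVertexCover_ge :
    ∃ d : ℕ, 10 ≤ d ∧ ∃ c : ℝ, 0 < c ∧
      ∀ n0 : ℕ,
        ∃ (V : Type) (_ : Fintype V) (_ : DecidableEq V)
          (G : SimpleGraph V) (_ : DecidableRel G.Adj),
          G.Connected ∧
          n0 ≤ Fintype.card V ∧
          d ≤ G.minDegree ∧
          G.maxDegree ≤ 2 * d ∧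
          (∀ X : Finset V, 1 ≤ X.card → 2 * X.card ≤ Fintype.card V →
            ((d : ℝ) / 20) * (X.card : ℝ) ≤
              (((X ×ˢ Xᶜ).filter fun p => G.Adj p.1 p.2).card : ℝ)) ∧
          ∃ (cfg : PermRotorConfig G) (x0 : V),
            ∀ t : ℕ, cfg.coversVertices x0 t →
              c * (Fintype.card V : ℝ) * Real.logb 2 (Fintype.card V : ℝ) ≤ (t : ℝ) := by
  classical
  refine ⟨145, by norm_num, 1 / 18, by norm_num, fun n0 => ?_⟩
  obtain ⟨n, hn1, hn2⟩ : ∃ n : ℕ, n0 ≤ n ∧ 2 ^ 37 ≤ n :=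
    ⟨max n0 (2 ^ 37), le_max_left _ _, le_max_right _ _⟩
  have hpos : 0 < n := lt_of_lt_of_le (by norm_num) hn2
  have : NeZero n := ⟨hpos.ne'⟩
  let g : ZMod 17 → Equiv.Perm (RotorAux.Tor n) := fun l => RotorAux.gen' n (RotorAux.lab l)
  let V : Type := RotorAux.Side (RotorAux.Tor n) ⊕ RotorAux.Side (RotorAux.Tor n)
  let G : SimpleGraph V := RotorAux.liftGraph g
  have : Nonempty V := ⟨Sum.inl ((0, 0), 0, 0)⟩
  have hcard : n ≤ Fintype.card V := by
    have h1 : Fintype.card V = (n * n * (17 * 17)) + (n * n * (17 * 17)) := by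
      simp only [V, RotorAux.Side, RotorAux.Tor, Fintype.card_sum, Fintype.card_prod, ZMod.card]
    rw [h1]; nlinarith
  have hdeg : ∀ v : V, G.degree v = 289 := fun v => RotorAux.lift_degree g v
  have hexp : ∀ X : Finset V, 1 ≤ X.card → 2 * X.card ≤ Fintype.card V →
      ((145 : ℕ) : ℝ) / 20 * (X.card : ℝ) ≤
        (((X ×ˢ Xᶜ).filter fun p => G.Adj p.1 p.2).card : ℝ) := fun X _ h2 => by
    convert RotorAux.lift_expansion g (RotorAux.gen_spec n) X h2
  refine ⟨V, inferInstance, inferInstance, G, inferInstance,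
    RotorAux.connected_of_expansion G hexp, hn1.trans hcard, ?_, ?_, hexp, ?_⟩
  · exact G.le_minDegree_of_forall_le_degree 145 fun v => by rw [hdeg]; norm_num
  · exact G.maxDegree_le_of_forall_degree_le 290 fun v => by rw [hdeg]; norm_num
  · exact RotorAux.cover_of_expansion G hdeg hexp (hn2.trans hcard)
end

section
/- Let x̃_0, x̃_1, …, x̃_{t+1} be a rotor walk on a finite connected simple graph whose rotor sequences are permutations of the neighbors, and suppose the directed edge (x̃_t, x̃_{t+1}) equals (x̃_0, x̃_1) and that (x̃_ℓ, x̃_{ℓ+1}) ≠ (x̃_0, x̃_1) for all 0 < ℓ < t. Then the directed edges (x̃_i, x̃_{i+1}) for 0 < i < t are pairwise distinct; that is, between two successive traversals of the same directed edge, the rotor walk traverses no other directed edge twice. -/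
namespace PermRotorConfig

variable {V : Type*} [Fintype V] [DecidableEq V] {G : SimpleGraph V} [DecidableRel G.Adj]

/-- Number of visits to `u` at times `0, …, l - 1`. -/
def visits (cfg : PermRotorConfig G) (x0 : V) (u : V) (l : ℕ) : ℕ :=
  ((Finset.range l).filter (fun k => cfg.pos x0 k = u)).card

lemma visits_succ (cfg : PermRotorConfig G) (x0 u : V) (l : ℕ) :
    cfg.visits x0 u (l + 1) = cfg.visits x0 u l + if cfg.pos x0 l = u then 1 else 0 := by
  unfold visits
  rw [Finset.card_filter, Finset.card_filter, Finset.sum_range_succ]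

lemma visits_succ_first (cfg : PermRotorConfig G) (x0 u : V) (l : ℕ) :
    cfg.visits x0 u (l + 1) = ((Finset.range l).filter (fun k => cfg.pos x0 (k + 1) = u)).card
      + if cfg.pos x0 0 = u then 1 else 0 := by
  unfold visits
  rw [Finset.card_filter, Finset.card_filter, Finset.sum_range_succ']

lemma visits_mono (cfg : PermRotorConfig G) (x0 u : V) : Monotone (cfg.visits x0 u) :=
  monotone_nat_of_le_succ fun l => by rw [visits_succ]; omega

lemma rotor_eq (cfg : PermRotorConfig G) (x0 u : V) (l : ℕ) :
    (cfg.state x0 l).2 u = cfg.r0 u + cfg.visits x0 u l := by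
  induction l with
  | zero => simp [state, visits]
  | succ l ih =>
    rw [visits_succ]
    have hs : (cfg.state x0 (l + 1)).2 = Function.update (cfg.state x0 l).2 (cfg.pos x0 l)
        ((cfg.state x0 l).2 (cfg.pos x0 l) + 1) := rfl
    rw [hs]
    by_cases h : cfg.pos x0 l = u
    · rw [if_pos h, h, Function.update_self]
      omega
    · rw [Function.update_of_ne (Ne.symm h), if_neg h]
      simpa using ih

lemma pos_succ (cfg : PermRotorConfig G) (x0 : V) (l : ℕ) :
    cfg.pos x0 (l + 1) =
      cfg.s (cfg.pos x0 l) (cfg.r0 (cfg.pos x0 l) + cfg.visits x0 (cfg.pos x0 l) l) := by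
  rw [← rotor_eq]
  rfl

lemma s_mod (cfg : PermRotorConfig G) (u : V) (i : ℕ) :
    cfg.s u (i % G.degree u) = cfg.s u i :=
  Function.Periodic.map_mod_nat (f := cfg.s u) (cfg.periodic u) i

lemma pos_adj (cfg : PermRotorConfig G) (hd : ∀ u, 0 < G.degree u) (x0 : V) (l : ℕ) :
    G.Adj (cfg.pos x0 l) (cfg.pos x0 (l + 1)) := by
  rw [pos_succ, ← s_mod]
  exact cfg.adj _ _ (Nat.mod_lt _ (hd _))

/-- The first repeated directed edge is the initial one. -/
lemma first_repeat (cfg : PermRotorConfig G) (hd : ∀ u, 0 < G.degree u) (x0 : V) (i j : ℕ)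
    (hij : i < j) (h1 : cfg.pos x0 i = cfg.pos x0 j)
    (h2 : cfg.pos x0 (i + 1) = cfg.pos x0 (j + 1))
    (hmin : ∀ a b, a < b → b < j →
      ¬ (cfg.pos x0 a = cfg.pos x0 b ∧ cfg.pos x0 (a + 1) = cfg.pos x0 (b + 1))) :
    i = 0 := by
  have hinj : ∀ a b, a < j → b < j → cfg.pos x0 a = cfg.pos x0 b →
      cfg.pos x0 (a + 1) = cfg.pos x0 (b + 1) → a = b := by
    intro a b ha hb h h'
    rcases lt_trichotomy a b with hab | hab | hab
    · exact absurd ⟨h, h'⟩ (hmin a b hab hb)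
    · exact hab
    · exact absurd ⟨h.symm, h'.symm⟩ (hmin b a hab ha)
  obtain ⟨u, hu⟩ : ∃ u, cfg.pos x0 j = u := ⟨_, rfl⟩
  have hui : cfg.pos x0 i = u := h1.trans hu
  have hout : cfg.visits x0 u j ≤ G.degree u := by
    rw [← G.card_neighborFinset_eq_degree]
    apply Finset.card_le_card_of_injOn (fun k => cfg.pos x0 (k + 1))
    · intro k hk
      simp only [Finset.coe_filter, Finset.mem_range, Set.mem_ofPred_eq] at hk
      have := cfg.pos_adj hd x0 k
      rw [hk.2] at this
      simpa using this
    · intro a ha b hb hab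
      simp only [Finset.coe_filter, Finset.mem_range, Set.mem_ofPred_eq] at ha hb
      exact hinj a b ha.1 hb.1 (ha.2.trans hb.2.symm) hab
  have hin : ((Finset.range j).filter (fun k => cfg.pos x0 (k + 1) = u)).card ≤ G.degree u := by
    rw [← G.card_neighborFinset_eq_degree]
    apply Finset.card_le_card_of_injOn (fun k => cfg.pos x0 k)
    · intro k hk
      simp only [Finset.coe_filter, Finset.mem_range, Set.mem_ofPred_eq] at hk
      have := cfg.pos_adj hd x0 k
      rw [hk.2] at this
      simpa using this.symm
    · intro a ha b hb hab
      simp only [Finset.coe_filter, Finset.mem_range, Set.mem_ofPred_eq] at ha hb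
      exact hinj a b ha.1 hb.1 hab (ha.2.trans hb.2.symm)
  have hlt : cfg.visits x0 u i < cfg.visits x0 u j := by
    have := cfg.visits_mono x0 u (show i + 1 ≤ j from hij)
    rw [visits_succ, if_pos hui] at this
    omega
  have hmod : (cfg.r0 u + cfg.visits x0 u i) ≡ (cfg.r0 u + cfg.visits x0 u j)
      [MOD G.degree u] := by
    rw [pos_succ, pos_succ, hu, hui, ← s_mod, ← s_mod _ _ (cfg.r0 u + cfg.visits x0 u j)] at h2
    exact cfg.inj u _ _ (Nat.mod_lt _ (hd u)) (Nat.mod_lt _ (hd u)) h2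
  have hmod2 := Nat.ModEq.add_left_cancel' _ hmod
  have hdvd := (Nat.modEq_iff_dvd' hlt.le).1 hmod2
  have hle := Nat.le_of_dvd (by omega) hdvd
  have h0 : cfg.visits x0 u i = 0 := by omega
  by_contra hi
  have hx : cfg.pos x0 0 ≠ u := by
    intro hx
    have := cfg.visits_mono x0 u (show 0 + 1 ≤ i by omega)
    rw [visits_succ, if_pos hx] at this
    omega
  have e1 := cfg.visits_succ x0 u j
  have e2 := cfg.visits_succ_first x0 u j
  rw [if_pos hu] at e1
  rw [if_neg hx] at e2
  omega

end PermRotorConfig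

/-- Priezzhev et al.. Consider a rotor walk `x̃_0, x̃_1, …, x̃_{t+1}` on a
finite connected simple graph whose rotor sequences are permutations of the neighbors.
If the directed edge `(x̃_t, x̃_{t+1})` equals `(x̃_0, x̃_1)` and `(x̃_ℓ, x̃_{ℓ+1}) ≠ (x̃_0, x̃_1)`
for all `0 < ℓ < t`, then the directed edges `(x̃_i, x̃_{i+1})` for `0 < i < t` are pairwise
distinct: between two successive traversals of the same directed edge, the rotor walk
traverses no other directed edge twice. -/
theorem rotorWalk_no_repeated_edge_between_repeats
    {V : Type*} [Fintype V] [DecidableEq V]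
    (G : SimpleGraph V) [DecidableRel G.Adj] (hconn : G.Connected)
    (cfg : PermRotorConfig G) (x0 : V) (t : ℕ)
    (hlast : cfg.pos x0 t = cfg.pos x0 0 ∧ cfg.pos x0 (t + 1) = cfg.pos x0 1)
    (hbetween : ∀ ℓ, 0 < ℓ → ℓ < t →
      ¬ (cfg.pos x0 ℓ = cfg.pos x0 0 ∧ cfg.pos x0 (ℓ + 1) = cfg.pos x0 1)) :
    ∀ i j, 0 < i → i < j → j < t →
      ¬ (cfg.pos x0 i = cfg.pos x0 j ∧ cfg.pos x0 (i + 1) = cfg.pos x0 (j + 1)) := by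
  intro i j hi hij hjt hrep
  rcases subsingleton_or_nontrivial V with hV | hV
  · exact hbetween 1 one_pos (by omega) ⟨Subsingleton.elim _ _, Subsingleton.elim _ _⟩
  have hd : ∀ u, 0 < G.degree u := fun u => hconn.preconnected.degree_pos_of_nontrivial u
  classical
  have hex : ∃ b, ∃ a, a < b ∧
      (cfg.pos x0 a = cfg.pos x0 b ∧ cfg.pos x0 (a + 1) = cfg.pos x0 (b + 1)) :=
    ⟨j, i, hij, hrep⟩
  obtain ⟨a, hab, h1, h2⟩ := Nat.find_spec hex
  have hle : Nat.find hex ≤ j := Nat.find_min' hex ⟨i, hij, hrep⟩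
  have ha := cfg.first_repeat hd x0 a (Nat.find hex) hab h1 h2
    (fun a' b' hab' hb' h => Nat.find_min hex hb' ⟨a', hab', h⟩)
  subst ha
  exact hbetween (Nat.find hex) hab (by omega) ⟨h1.symm, h2.symm⟩
end

section
/- Let n be such that √n is an odd integer, and let G be the two-dimensional torus with vertex set {(x,y) : −L ≤ x,y ≤ L} where L=(√n−1)/2, vertices adjacent iff they differ by ±1 (mod √n) in exactly one coordinate. Equip every vertex with the clockwise cyclic rotor sequence (up, right, down, left), and let the initial rotor of vertex (x,y) point: up if (y ≤ −1 and y ≤ −x and y < x) or (x,y)=(0,0); right if x ≤ −1 and −x > y and x ≤ y; down if y ≥ 1 and y ≥ −x and y > x; left if x ≥ 1 and −x < y and x ≥ y. Then the rotor walk started at the origin (0,0) needs (16/3)L³ + 8L² + (8/3)L = (2/3)(n^{3/2} − √n) steps to visit every vertex; in particular, the deterministic vertex cover time of the two-dimensional torus satisfies ṼC(G) ≥ (2/3)(n^{3/2} − √n). -/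
/-- The signed representative in `{−(N−1)/2, …, (N−1)/2}` of an element of `ℤ/Nℤ`
(for odd `N`). -/
def signedRep {N : ℕ} [NeZero N] (a : ZMod N) : ℤ :=
  if 2 * a.val + 1 ≤ N then (a.val : ℤ) else (a.val : ℤ) - N

namespace RT

/-- sup norm -/
def M (x y : ℤ) : ℤ := max (max x (-x)) (max y (-y))

/-- initial rotor -/
def r0 (x y : ℤ) : ℕ :=
  if (y ≤ -1 ∧ y ≤ - x ∧ y < x) ∨ (x = 0 ∧ y = 0) then 0
  else if x ≤ -1 ∧ y < - x ∧ x ≤ y then 1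
  else if 1 ≤ y ∧ - x ≤ y ∧ x < y then 2
  else 3

def dg (x y : ℤ) : ℤ := if x = y ∨ x = -y then 1 else 0
def cl (x y : ℤ) : ℤ := if x = 0 ∧ 0 < y then 1 else 0
def tp (L x y : ℤ) : ℤ := if y = L ∧ 0 ≤ x then 1 else 0

/-- number of exits -/
def fz (L x y : ℤ) : ℤ := 4 * (L - M x y) + 2 - dg x y + cl x y - tp L x y

def d0 (L x y : ℤ) : ℤ :=
  if (y ≤ -1 ∧ x ≤ -y ∧ y < x) ∨ (1 ≤ x ∧ -x < y ∧ y < x) ∨ (x = 0 ∧ 0 ≤ y ∧ y < L) then 1 else 0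
def d1 (x y : ℤ) : ℤ :=
  if (y ≤ -1 ∧ y < x ∧ x < -y) ∨ (x ≤ -1 ∧ x ≤ y ∧ y < -x) then 1 else 0
def d2 (x y : ℤ) : ℤ :=
  if (x ≤ -1 ∧ x < y ∧ y < -x) ∨ (1 ≤ y ∧ -y ≤ x ∧ x < y) then 1 else 0
def d3 (L x y : ℤ) : ℤ :=
  if (1 ≤ y ∧ -y < x ∧ x < y ∧ ¬ (y = L ∧ 0 < x)) ∨
    (1 ≤ x ∧ -x < y ∧ y ≤ x ∧ ¬ (x = L ∧ y = L)) then 1 else 0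

def cnt (d a b : ℕ) : ℕ := (b + 3 - d) / 4 - (a + 3 - d) / 4

lemma M_le {L x y : ℤ} (hx : -L ≤ x) (hx' : x ≤ L) (hy : -L ≤ y) (hy' : y ≤ L) : M x y ≤ L := by
  unfold M; omega

def wp (L x : ℤ) : ℤ := if x = L then -L else x + 1
def wm (L x : ℤ) : ℤ := if x = -L then L else x - 1

set_option maxHeartbeats 4000000 in
lemma cnts {L x y : ℤ} (hL : 1 ≤ L) (hx : -L ≤ x) (hx' : x ≤ L) (hy : -L ≤ y) (hy' : y ≤ L) :
    (cnt 0 (r0 x y) (r0 x y + (fz L x y).toNat) : ℤ) = L - M x y + d0 L x y ∧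
    (cnt 1 (r0 x y) (r0 x y + (fz L x y).toNat) : ℤ) = L - M x y + d1 x y ∧
    (cnt 2 (r0 x y) (r0 x y + (fz L x y).toNat) : ℤ) = L - M x y + d2 x y ∧
    (cnt 3 (r0 x y) (r0 x y + (fz L x y).toNat) : ℤ) = L - M x y + d3 L x y := by
  have h := M_le hx hx' hy hy'
  have key : (x = y ∨ x = -y ∨ (x < y ∧ -y < x) ∨ (y < x ∧ x < -y) ∨ (x < y ∧ x < -y) ∨ (y < x ∧ -y < x)) := by omega
  have key2 : x = 0 ∨ 0 < x ∨ x < 0 := by omega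
  have e2 : (y = L ∨ y < L) := by omega
  have e1 : (x = L ∨ x < L) := by omega
  unfold cnt fz
  generalize M x y = m at *
  rcases key with k | k | k | k | k | k <;>
    rcases key2 with k2 | k2 | k2 <;>
    rcases e2 with e2 | e2 <;> rcases e1 with e1 | e1 <;> (try (exfalso; omega)) <;>
    unfold r0 dg cl tp d0 d1 d2 d3 <;>
    simp (disch := omega) only [if_pos, if_neg] <;>
    omega

set_option maxHeartbeats 4000000 in
lemma balance {L x y : ℤ} (hL : 1 ≤ L) (hx : -L ≤ x) (hx' : x ≤ L) (hy : -L ≤ y) (hy' : y ≤ L) :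
    (L - M x (wm L y) + d0 L x (wm L y)) + (L - M (wm L x) y + d1 (wm L x) y)
    + (L - M x (wp L y) + d2 x (wp L y)) + (L - M (wp L x) y + d3 L (wp L x) y)
    + (if x = 0 ∧ y = 0 then 1 else 0)
    = fz L x y + (if x = L ∧ y = L then 1 else 0) := by
  have key : (x = y ∨ x = -y ∨ (x < y ∧ -y < x) ∨ (y < x ∧ x < -y) ∨ (x < y ∧ x < -y) ∨ (y < x ∧ -y < x)) := by omega
  have key2 : x = 0 ∨ x = 1 ∨ x = -1 ∨ 2 ≤ x ∨ x ≤ -2 := by omega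
  have key3 : y = 0 ∨ y = 1 ∨ y = -1 ∨ 2 ≤ y ∨ y ≤ -2 := by omega
  unfold fz
  have e1 : (x = L ∨ x = -L ∨ (x < L ∧ -L < x)) := by omega
  have e2 : (y = L ∨ y = -L ∨ (y < L ∧ -L < y)) := by omega
  rcases e1 with e1 | e1 | e1 <;> rcases e2 with e2 | e2 | e2 <;>
    rcases key with k | k | k | k | k | k <;> (try (exfalso; omega)) <;>
    rcases key2 with k2 | k2 | k2 | k2 | k2 <;> (try (exfalso; omega)) <;>
    rcases key3 with k3 | k3 | k3 | k3 | k3 <;> (try (exfalso; omega)) <;>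
    unfold wp wm <;>
    simp (disch := omega) only [if_pos, if_neg] <;>
    unfold d0 d1 d2 d3 dg cl tp M <;>
    simp (disch := omega) only [if_pos, if_neg] <;>
    omega


def rk (L x y : ℤ) : ℤ :=
  if y = L ∧ 0 < x ∧ x < L then 7 * L + 2 + x
  else if x = L then L - y
  else if y = L then 7 * L + x
  else if x = -L then 5 * L + y
  else if y = -L then 3 * L - x
  else if 0 ≤ x ∧ x ≤ y then 8 * L - y + x
  else if x < 0 ∧ -x ≤ y then 8 * L - y + (8 * y + x)
  else if 0 < x ∧ -x ≤ y then 8 * L - x + (2 * x - y)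
  else if y < 0 ∧ y ≤ x then 8 * L + y + (-4 * y - x)
  else 8 * L + x + (-6 * x + y)

lemma fz_nonneg {L x y : ℤ} (hx : -L ≤ x) (hx' : x ≤ L) (hy : -L ≤ y) (hy' : y ≤ L) :
    0 ≤ fz L x y := by
  have h := M_le hx hx' hy hy'
  unfold fz dg cl tp
  split_ifs <;> omega

lemma fz_corner {L : ℤ} (hL : 1 ≤ L) : fz L L L = 0 := by
  have h : M L L = L := by unfold M; omega
  unfold fz dg cl tp
  rw [h, if_pos (by omega), if_neg (by omega), if_pos (by omega)]
  omega

set_option maxHeartbeats 4000000 in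
lemma rank {L x y : ℤ} (hL : 1 ≤ L) (hx : -L ≤ x) (hx' : x ≤ L) (hy : -L ≤ y) (hy' : y ≤ L)
    (hf : 0 < fz L x y) :
    ((r0 x y + (fz L x y).toNat - 1) % 4 = 0 → rk L x (wp L y) < rk L x y) ∧
    ((r0 x y + (fz L x y).toNat - 1) % 4 = 1 → rk L (wp L x) y < rk L x y) ∧
    ((r0 x y + (fz L x y).toNat - 1) % 4 = 2 → rk L x (wm L y) < rk L x y) ∧
    ((r0 x y + (fz L x y).toNat - 1) % 4 = 3 → rk L (wm L x) y < rk L x y) := by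
  have key : (x = y ∨ x = -y ∨ (x < y ∧ -y < x) ∨ (y < x ∧ x < -y) ∨ (x < y ∧ x < -y) ∨ (y < x ∧ -y < x)) := by omega
  have key2 : x = 0 ∨ 0 < x ∨ x < 0 := by omega
  have key3 : y = 0 ∨ 0 < y ∨ y < 0 := by omega
  have e1 : (x = L ∨ x = -L ∨ (x < L ∧ -L < x)) := by omega
  have e2 : (y = L ∨ y = -L ∨ (y < L ∧ -L < y)) := by omega
  have h := M_le hx hx' hy hy'
  have h2 : x ≤ M x y := by unfold M; omega
  revert hf
  unfold fz
  generalize M x y = m at *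
  rcases e1 with e1 | e1 | e1 <;> rcases e2 with e2 | e2 | e2 <;>
    rcases key with k | k | k | k | k | k <;> (try (exfalso; omega)) <;>
    rcases key2 with k2 | k2 | k2 <;> (try (exfalso; omega)) <;>
    rcases key3 with k3 | k3 | k3 <;> (try (exfalso; omega)) <;>
    unfold wp wm r0 dg cl tp <;>
    simp (disch := omega) only [if_pos, if_neg] <;>
    intro hf <;> refine ⟨?_, ?_, ?_, ?_⟩ <;> intro hd <;> (try (exfalso; omega)) <;>
    unfold rk <;> simp (disch := omega) only [if_pos, if_neg] <;>
    omega

lemma M_le_iff {k x y : ℤ} : M x y ≤ k ↔ (-k ≤ x ∧ x ≤ k) ∧ (-k ≤ y ∧ y ≤ k) := by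
  unfold M; omega

/-- summation of the odometer over the box -/
lemma sum_fz (l : ℕ) :
    3 * ∑ x ∈ Finset.Icc (-(l:ℤ)) l, ∑ y ∈ Finset.Icc (-(l:ℤ)) l, fz l x y
      = 16 * (l:ℤ)^3 + 24 * (l:ℤ)^2 + 8 * l := by
  have hM : ∀ x ∈ Finset.Icc (-(l:ℤ)) l, ∀ y ∈ Finset.Icc (-(l:ℤ)) l,
      (l:ℤ) - M x y = ∑ k ∈ Finset.range l, if M x y ≤ k then 1 else 0 := by
    intro x hx y hy
    rw [Finset.mem_Icc] at hx hy
    have h1 := M_le hx.1 hx.2 hy.1 hy.2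
    have h0 : 0 ≤ M x y := by unfold M; omega
    obtain ⟨m, hm⟩ := Int.eq_ofNat_of_zero_le h0
    rw [hm] at h1 ⊢
    rw [Finset.sum_boole]
    have : (Finset.range l).filter (fun k : ℕ => (m:ℤ) ≤ k) = Finset.Ico m l := by
      ext k; simp; omega
    rw [this]; simp; omega
  have hbox : ∀ k ∈ Finset.range l, ∑ x ∈ Finset.Icc (-(l:ℤ)) l, ∑ y ∈ Finset.Icc (-(l:ℤ)) l,
      (if M x y ≤ k then (1:ℤ) else 0) = (2 * k + 1)^2 := by
    intro k hk
    rw [Finset.mem_range] at hk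
    rw [← Finset.sum_product', Finset.sum_boole]
    have : ((Finset.Icc (-(l:ℤ)) l ×ˢ Finset.Icc (-(l:ℤ)) l).filter (fun p => M p.1 p.2 ≤ k))
      = Finset.Icc (-(k:ℤ)) k ×ˢ Finset.Icc (-(k:ℤ)) k := by
      ext ⟨x, y⟩; simp [M_le_iff]; omega
    rw [this, Finset.card_product, Int.card_Icc]
    have : (((k:ℤ) + 1 - -(k:ℤ)).toNat : ℤ) = 2 * k + 1 := by omega
    push_cast [this]; ring
  have hsq : ∀ n : ℕ, 3 * ∑ k ∈ Finset.range n, (2 * (k:ℤ) + 1)^2 = 4 * (n:ℤ)^3 - n := by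
    intro n
    induction n with
    | zero => simp
    | succ n ih => rw [Finset.sum_range_succ, mul_add, ih]; push_cast; ring
  have hA : 3 * ∑ x ∈ Finset.Icc (-(l:ℤ)) l, ∑ y ∈ Finset.Icc (-(l:ℤ)) l, ((l:ℤ) - M x y)
      = 4 * (l:ℤ)^3 - l := by
    rw [← hsq, ← Finset.sum_congr rfl hbox]
    congr 1
    rw [Finset.sum_congr rfl fun x hx => Finset.sum_congr rfl (hM x hx)]
    rw [Finset.sum_comm]
    rw [Finset.sum_congr rfl fun x hx => Finset.sum_comm]
    rw [Finset.sum_comm]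
    rw [Finset.sum_congr rfl fun x hx => Finset.sum_comm]
  have hc : (Finset.Icc (-(l:ℤ)) l).card = 2 * l + 1 := by rw [Int.card_Icc]; omega
  have hD : ∑ x ∈ Finset.Icc (-(l:ℤ)) l, ∑ y ∈ Finset.Icc (-(l:ℤ)) l, dg x y = 4 * l + 1 := by
    have : ∀ x y, dg x y = (if x = y then 1 else 0) + (if -x = y then 1 else 0)
        - (if x = 0 then if 0 = y then 1 else 0 else 0) := by
      intro x y; unfold dg; split_ifs <;> omega
    simp only [this, Finset.sum_sub_distrib, Finset.sum_add_distrib, Finset.sum_ite_eq]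
    rw [Finset.sum_congr rfl (g := fun _ => (1:ℤ)) (by intro x hx; simp_all),
      Finset.sum_congr rfl (g := fun _ => (1:ℤ)) (s₁ := Finset.Icc (-(l:ℤ)) l) (f := fun x => if -x ∈ Finset.Icc (-(l:ℤ)) l then 1 else 0) (by intro x hx; simp at hx ⊢; omega)]
    have h3 : ∑ x ∈ Finset.Icc (-(l:ℤ)) l, ∑ y ∈ Finset.Icc (-(l:ℤ)) l,
      (if x = 0 then if 0 = y then (1:ℤ) else 0 else 0) = 1 := by
      rw [Finset.sum_eq_single 0] <;> simp +contextual
    rw [h3]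
    simp [hc]; ring
  have hC : ∑ x ∈ Finset.Icc (-(l:ℤ)) l, ∑ y ∈ Finset.Icc (-(l:ℤ)) l, cl x y = l := by
    rw [Finset.sum_eq_single 0]
    · simp only [cl, true_and, Finset.sum_boole]
      have : (Finset.Icc (-(l:ℤ)) l).filter (fun y => 0 < y) = Finset.Icc 1 (l:ℤ) := by
        ext; simp; omega
      rw [this]; simp
    · intro x _ hx; simp [cl, hx]
    · simp
  have hT : ∑ x ∈ Finset.Icc (-(l:ℤ)) l, ∑ y ∈ Finset.Icc (-(l:ℤ)) l, tp l x y = l + 1 := by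
    rw [Finset.sum_comm, Finset.sum_eq_single (l:ℤ)]
    · simp only [tp, true_and, Finset.sum_boole]
      have : (Finset.Icc (-(l:ℤ)) l).filter (fun y => 0 ≤ y) = Finset.Icc 0 (l:ℤ) := by
        ext; simp; omega
      rw [this]; simp
    · intro x _ hx; simp [tp, hx]
    · simp
  simp only [fz, Finset.sum_sub_distrib, Finset.sum_add_distrib, ← Finset.mul_sum, hD, hC, hT] at hA ⊢
  simp only [Finset.sum_const, hc, nsmul_eq_mul] at hA ⊢
  push_cast at hA ⊢
  linear_combination 4 * hA

end RT

namespace RT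
open Finset

section abs
variable {V : Type*} [Fintype V] [DecidableEq V] {G : SimpleGraph V} [DecidableRel G.Adj]

/-- entries into `w` if the rotors advance from `cfg.r0` to `F` -/
def ent (cfg : PermRotorConfig G) (F : V → ℕ) (w : V) : ℕ :=
  ∑ u, ∑ i ∈ Ico (cfg.r0 u) (F u), if cfg.s u i = w then 1 else 0

lemma ent_mono (cfg : PermRotorConfig G) {F F' : V → ℕ} (h : ∀ u, F u ≤ F' u) (w : V) :
    ent cfg F w ≤ ent cfg F' w := by
  unfold ent
  refine sum_le_sum fun u _ => sum_le_sum_of_subset (Ico_subset_Ico le_rfl (h u))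

lemma ent_lt (cfg : PermRotorConfig G) {F F' : V → ℕ} (h : ∀ u, F u ≤ F' u) (u : V)
    (h0 : cfg.r0 u ≤ F u) (hu : F u < F' u) :
    ent cfg F (cfg.s u (F' u - 1)) < ent cfg F' (cfg.s u (F' u - 1)) := by
  unfold ent
  refine sum_lt_sum (fun u _ => sum_le_sum_of_subset (Ico_subset_Ico le_rfl (h u))) ⟨u, mem_univ _, ?_⟩
  refine sum_lt_sum_of_subset (Ico_subset_Ico le_rfl (h u)) (i := F' u - 1) ?_ ?_ ?_ ?_
  · simp; omega
  · simp; omega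
  · simp
  · simp

lemma r0_le (cfg : PermRotorConfig G) (x0 : V) (t : ℕ) (u : V) :
    cfg.r0 u ≤ (cfg.state x0 t).2 u := by
  induction t with
  | zero => exact le_rfl
  | succ t ih =>
    simp only [PermRotorConfig.state, PermRotorConfig.step, Function.update_apply]
    split_ifs with h
    · subst h; omega
    · exact ih

lemma ent_update (cfg : PermRotorConfig G) (F : V → ℕ) (u w : V) (h0 : cfg.r0 u ≤ F u) :
    ent cfg (Function.update F u (F u + 1)) w = ent cfg F w + if cfg.s u (F u) = w then 1 else 0 := by
  unfold ent
  rw [← add_sum_erase _ _ (mem_univ u), ← add_sum_erase (f := fun u => ∑ i ∈ Ico (cfg.r0 u) (F u), if cfg.s u i = w then 1 else 0) _ (mem_univ u)]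
  rw [Function.update_self, sum_Ico_succ_top h0]
  rw [sum_congr rfl (g := fun u => ∑ i ∈ Ico (cfg.r0 u) (F u), if cfg.s u i = w then 1 else 0)]
  · omega
  · intro x hx
    rw [Function.update_of_ne (ne_of_mem_erase hx)]

lemma flow (cfg : PermRotorConfig G) (x0 : V) (t : ℕ) (w : V) :
    ent cfg (cfg.state x0 t).2 w + cfg.r0 w + (if w = x0 then 1 else 0)
      = (cfg.state x0 t).2 w + if w = (cfg.state x0 t).1 then 1 else 0 := by
  induction t with
  | zero =>
    have h : cfg.state x0 0 = (x0, cfg.r0) := rfl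
    rw [h]; simp [ent]
  | succ t ih =>
    have h : cfg.state x0 (t + 1) = cfg.step (cfg.state x0 t) := rfl
    have h0 := r0_le cfg x0 t
    rw [h]
    generalize cfg.state x0 t = st at *
    have h' : cfg.step st = (cfg.s st.1 (st.2 st.1), Function.update st.2 st.1 (st.2 st.1 + 1)) := rfl
    rw [h']
    clear h h'
    dsimp only
    rw [ent_update _ _ _ _ (h0 _), Function.update_apply]
    have : (cfg.s st.1 (st.2 st.1) = w) ↔ (w = cfg.s st.1 (st.2 st.1)) := eq_comm
    simp only [this]
    by_cases h : w = st.1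
    · subst h; simp only [if_true] at ih ⊢; omega
    · simp only [h, if_false] at ih ⊢; omega

lemma time (cfg : PermRotorConfig G) (x0 : V) (t : ℕ) :
    ∑ u, (cfg.state x0 t).2 u = ∑ u, cfg.r0 u + t := by
  induction t with
  | zero => simp [PermRotorConfig.state]
  | succ t ih =>
    simp only [PermRotorConfig.state, PermRotorConfig.step]
    rw [sum_update_of_mem (mem_univ _)]
    have := add_sum_erase univ (cfg.state x0 t).2 (mem_univ (cfg.state x0 t).1)
    rw [sdiff_singleton_eq_erase]
    omega

lemma abs_main {α : Type*} [LinearOrder α] (cfg : PermRotorConfig G) (x0 v : V) (F : V → ℕ)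
    (hF : ∀ u, cfg.r0 u ≤ F u)
    (hbal : ∀ w, ent cfg F w + cfg.r0 w + (if w = x0 then 1 else 0) = F w + if w = v then 1 else 0)
    (rank : V → α) (hrank : ∀ u, cfg.r0 u < F u → rank (cfg.s u (F u - 1)) < rank u)
    (t : ℕ) (ht : cfg.pos x0 t = v) : ∑ u, F u ≤ ∑ u, cfg.r0 u + t := by
  classical
  have hex : ∃ t, cfg.pos x0 t = v := ⟨t, ht⟩
  set T := Nat.find hex with hT
  have hTv : cfg.pos x0 T = v := Nat.find_spec hex
  have hTt : T ≤ t := Nat.find_min' hex ht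
  have hle : ∀ s ≤ T, ∀ u, (cfg.state x0 s).2 u ≤ F u := by
    intro s
    induction s with
    | zero => intro _ u; exact hF u
    | succ s ih =>
      intro hs u
      have ih := ih (by omega)
      have hne : cfg.pos x0 s ≠ v := Nat.find_min hex (by omega)
      simp only [PermRotorConfig.state, PermRotorConfig.step, Function.update_apply]
      split_ifs with h
      · have h1 := flow cfg x0 s u
        have h2 := hbal u
        have h3 := ent_mono cfg ih u
        have h4 : u ≠ v := by rw [h]; exact hne
        rw [if_pos h] at h1
        rw [if_neg h4] at h2
        rw [← h]; omega
      · exact ih u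
  have hT' := hle T le_rfl
  have heq : ∀ u, F u ≤ (cfg.state x0 T).2 u := by
    by_contra hcon
    push Not at hcon
    obtain ⟨u, hu, hmin⟩ := exists_min_image (univ.filter fun u => (cfg.state x0 T).2 u < F u) rank
      (by obtain ⟨u, hu⟩ := hcon; exact ⟨u, by simpa using hu⟩)
    simp only [mem_filter, mem_univ, true_and] at hu hmin
    have h0 := r0_le cfg x0 T u
    have h1 := ent_lt cfg hT' u h0 hu
    have h2 := hrank u (by omega)
    refine absurd h2 (not_lt.mpr (hmin _ ?_))
    have h3 := flow cfg x0 T (cfg.s u (F u - 1))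
    have h4 := hbal (cfg.s u (F u - 1))
    have h5 : (cfg.state x0 T).1 = v := hTv
    rw [h5] at h3
    omega
  have := time cfg x0 T
  have h6 := sum_le_sum (s := univ) fun u _ => heq u
  omega

end abs
end RT

namespace RT
open Finset

section torus
variable {N : ℕ} [NeZero N]

lemma sr_bounds (l : ℕ) (hN : N = 2 * l + 1) (a : ZMod N) :
    -(l:ℤ) ≤ signedRep a ∧ signedRep a ≤ l := by
  have := ZMod.val_lt a
  unfold signedRep
  split_ifs <;> omega

lemma sr_cast (a : ZMod N) : ((signedRep a : ℤ) : ZMod N) = a := by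
  unfold signedRep
  split_ifs <;> simp

lemma sr_unique (l : ℕ) (hN : N = 2 * l + 1) (a : ZMod N) (z : ℤ) (h1 : -(l:ℤ) ≤ z)
    (h2 : z ≤ l) (h : (z : ZMod N) = a) : signedRep a = z := by
  have hb := sr_bounds l hN a
  have : ((signedRep a : ℤ) : ZMod N) = (z : ZMod N) := by rw [sr_cast, h]
  rw [ZMod.intCast_eq_intCast_iff_dvd_sub] at this
  obtain ⟨c, hc⟩ := this
  have : c = 0 := by
    have h3 : (N:ℤ) = 2 * l + 1 := by exact_mod_cast hN
    rw [h3] at hc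
    by_contra hne
    rcases lt_or_gt_of_ne hne with h | h
    · nlinarith
    · nlinarith
  subst this; omega

lemma cast_N (l : ℕ) (hN : N = 2 * l + 1) : (2 * (l : ZMod N) + 1) = 0 := by
  have : ((2 * l + 1 : ℕ) : ZMod N) = 0 := by rw [← hN]; simp
  push_cast at this; exact this

lemma sr_add (l : ℕ) (hN : N = 2 * l + 1) (a : ZMod N) :
    signedRep (a + 1) = wp l (signedRep a) := by
  have hb := sr_bounds l hN a
  have h := sr_cast a
  have h0 := cast_N l hN
  unfold wp
  split_ifs with h1
  · refine sr_unique l hN _ _ (by omega) (by omega) ?_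
    rw [h1] at h
    push_cast at h ⊢
    rw [← h]; linear_combination -h0
  · refine sr_unique l hN _ _ (by omega) (by omega) ?_
    push_cast; rw [h]

lemma sr_sub (l : ℕ) (hN : N = 2 * l + 1) (a : ZMod N) :
    signedRep (a - 1) = wm l (signedRep a) := by
  have hb := sr_bounds l hN a
  have h := sr_cast a
  have h0 := cast_N l hN
  unfold wm
  split_ifs with h1
  · refine sr_unique l hN _ _ (by omega) (by omega) ?_
    rw [h1] at h
    push_cast at h ⊢
    rw [← h]; linear_combination h0
  · refine sr_unique l hN _ _ (by omega) (by omega) ?_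
    push_cast; rw [h]

lemma sum_sr (l : ℕ) (hN : N = 2 * l + 1) (g : ℤ → ℤ) :
    ∑ a : ZMod N, g (signedRep a) = ∑ x ∈ Icc (-(l:ℤ)) l, g x := by
  refine sum_bij (fun a _ => signedRep a) ?_ ?_ ?_ ?_
  · intro a _; have := sr_bounds l hN a; simpa using this
  · intro a _ b _ h; rw [← sr_cast a, ← sr_cast b]; exact congrArg _ h
  · intro z hz
    rw [mem_Icc] at hz
    exact ⟨(z : ZMod N), mem_univ _, sr_unique l hN _ _ hz.1 hz.2 rfl⟩
  · intro a _; rfl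

end torus

lemma card_cnt (d : ℕ) (hd : d < 4) (a b : ℕ) (h : a ≤ b) :
    (∑ i ∈ Ico a b, if i % 4 = d then 1 else 0) = cnt d a b := by
  induction b, h using Nat.le_induction with
  | base => simp [cnt]
  | succ b hb ih =>
    rw [sum_Ico_succ_top hb, ih]
    unfold cnt
    split_ifs <;> omega

lemma degree_four {N : ℕ} [NeZero N] (l : ℕ) (hl : 1 ≤ l) (hN : N = 2 * l + 1)
    (G : SimpleGraph (ZMod N × ZMod N)) [DecidableRel G.Adj]
    (hadj : ∀ x y : ZMod N × ZMod N, G.Adj x y ↔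
      ((x.1 = y.1 ∧ (x.2 = y.2 + 1 ∨ x.2 = y.2 - 1)) ∨
       (x.2 = y.2 ∧ (x.1 = y.1 + 1 ∨ x.1 = y.1 - 1)))) (u : ZMod N × ZMod N) :
    G.degree u = 4 := by
  obtain ⟨a, b⟩ := u
  have h1 : ∀ c : ZMod N, c + 1 ≠ c := by
    intro c h
    have h' := congrArg signedRep h
    rw [sr_add l hN] at h'
    have := sr_bounds l hN c
    unfold wp at h'; split_ifs at h' <;> omega
  have h2 : ∀ c : ZMod N, c - 1 ≠ c := by
    intro c h
    exact h1 (c - 1) (by rw [sub_add_cancel, h])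
  have h3 : ∀ c : ZMod N, c + 1 ≠ c - 1 := by
    intro c h
    have h' := congrArg signedRep h
    rw [sr_add l hN, sr_sub l hN] at h'
    have := sr_bounds l hN c
    unfold wp wm at h'; split_ifs at h' <;> omega
  have : G.neighborFinset (a, b) = {(a, b + 1), (a + 1, b), (a, b - 1), (a - 1, b)} := by
    ext ⟨c, d⟩
    simp only [SimpleGraph.mem_neighborFinset, hadj, mem_insert, mem_singleton, Prod.mk.injEq]
    have e1 : a = c + 1 ↔ c = a - 1 := by constructor <;> intro h <;> rw [h] <;> ring
    have e2 : b = d + 1 ↔ d = b - 1 := by constructor <;> intro h <;> rw [h] <;> ring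
    have e3 : a = c - 1 ↔ c = a + 1 := by constructor <;> intro h <;> rw [h] <;> ring
    have e4 : b = d - 1 ↔ d = b + 1 := by constructor <;> intro h <;> rw [h] <;> ring
    rw [e1, e2, e3, e4, eq_comm (a := a) (b := c), eq_comm (a := b) (b := d)]
    tauto
  rw [← SimpleGraph.card_neighborFinset_eq_degree, this]
  rw [card_insert_of_notMem, card_insert_of_notMem, card_insert_of_notMem, card_singleton]
  · simpa using fun h => absurd h.symm (h2 a)
  · simp only [mem_insert, mem_singleton, Prod.mk.injEq, not_or, not_and]
    exact ⟨fun h => absurd h (h1 a), fun h => absurd h (h3 a)⟩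
  · simp only [mem_insert, mem_singleton, Prod.mk.injEq, not_or, not_and]
    exact ⟨fun h => absurd h.symm (h1 a), fun _ => h3 b, fun h => absurd h.symm (h2 a)⟩

end RT

/-- Let `√n = N` be odd and let `G` be the two-dimensional torus on
`n = N²` vertices with coordinates `−L ≤ x, y ≤ L`, `L = (N−1)/2`.  Equip every vertex
with the clockwise cyclic rotor sequence (up, right, down, left) and the initial rotor
directions described in the paper (all rotors pointing towards the origin).  Then the
rotor walk started at the origin needs `(16/3)L³ + 8L² + (8/3)L = (2/3)(n^{3/2} − √n)`
steps to visit every vertex; in particular `ṼC(G) ≥ (2/3)(n^{3/2} − √n)`. -/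
theorem detVertexCover_torus2_ge (N : ℕ) [NeZero N] (hodd : Odd N)
    (G : SimpleGraph (ZMod N × ZMod N)) [DecidableRel G.Adj]
    (hadj : ∀ x y : ZMod N × ZMod N, G.Adj x y ↔
      ((x.1 = y.1 ∧ (x.2 = y.2 + 1 ∨ x.2 = y.2 - 1)) ∨
       (x.2 = y.2 ∧ (x.1 = y.1 + 1 ∨ x.1 = y.1 - 1))))
    (cfg : PermRotorConfig G)
    (hs : ∀ u : ZMod N × ZMod N,
      cfg.s u 0 = (u.1, u.2 + 1) ∧ cfg.s u 1 = (u.1 + 1, u.2) ∧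
      cfg.s u 2 = (u.1, u.2 - 1) ∧ cfg.s u 3 = (u.1 - 1, u.2))
    (hr0 : ∀ u : ZMod N × ZMod N,
      cfg.r0 u =
        if (signedRep u.2 ≤ -1 ∧ signedRep u.2 ≤ - signedRep u.1 ∧
              signedRep u.2 < signedRep u.1) ∨
           (signedRep u.1 = 0 ∧ signedRep u.2 = 0) then 0
        else if signedRep u.1 ≤ -1 ∧ signedRep u.2 < - signedRep u.1 ∧
              signedRep u.1 ≤ signedRep u.2 then 1
        else if 1 ≤ signedRep u.2 ∧ - signedRep u.1 ≤ signedRep u.2 ∧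
              signedRep u.1 < signedRep u.2 then 2
        else 3) :
    ∀ t : ℕ, cfg.coversVertices (0, 0) t →
      (16 / 3 : ℝ) * (((N - 1) / 2 : ℕ) : ℝ) ^ 3 + 8 * (((N - 1) / 2 : ℕ) : ℝ) ^ 2 +
          (8 / 3 : ℝ) * (((N - 1) / 2 : ℕ) : ℝ) ≤ (t : ℝ) := by
  intro t hcov
  obtain ⟨l, hN⟩ := hodd
  have hl : (N - 1) / 2 = l := by omega
  rw [hl]
  rcases Nat.eq_zero_or_pos l with h0 | hpos
  · subst h0; simp
  have hL : (1:ℤ) ≤ l := by exact_mod_cast hpos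
  have hdeg := RT.degree_four l hpos hN G hadj
  have hmod : ∀ u i, cfg.s u i = cfg.s u (i % 4) := by
    intro u i
    have hq : ∀ q j, cfg.s u (j + 4 * q) = cfg.s u j := by
      intro q j
      induction q with
      | zero => rfl
      | succ q ih =>
        have := cfg.periodic u (j + 4 * q)
        rw [hdeg] at this
        rw [← ih, ← this]; congr 1
    have := hq (i / 4) (i % 4)
    rwa [Nat.mod_add_div] at this
  have hb := RT.sr_bounds l hN
  have hr : ∀ u, cfg.r0 u = RT.r0 (signedRep u.1) (signedRep u.2) := by
    intro u; rw [hr0]; rfl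
  let f : ZMod N × ZMod N → ℕ := fun u => (RT.fz l (signedRep u.1) (signedRep u.2)).toNat
  let F : ZMod N × ZMod N → ℕ := fun u => cfg.r0 u + f u
  let v : ZMod N × ZMod N := ((l : ZMod N), (l : ZMod N))
  have hsl : signedRep (l : ZMod N) = l := RT.sr_unique l hN _ l (by omega) le_rfl (by simp)
  have hs0 : signedRep (0 : ZMod N) = 0 := RT.sr_unique l hN _ 0 (by omega) (by omega) (by simp)
  have hinj : ∀ a b : ZMod N, a = b ↔ signedRep a = signedRep b := by
    intro a b
    exact ⟨fun h => by rw [h], fun h => by rw [← RT.sr_cast a, ← RT.sr_cast b, h]⟩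
  have hent : ∀ w : ZMod N × ZMod N, RT.ent cfg F w =
      RT.cnt 0 (cfg.r0 (w.1, w.2 - 1)) (F (w.1, w.2 - 1)) +
      RT.cnt 1 (cfg.r0 (w.1 - 1, w.2)) (F (w.1 - 1, w.2)) +
      RT.cnt 2 (cfg.r0 (w.1, w.2 + 1)) (F (w.1, w.2 + 1)) +
      RT.cnt 3 (cfg.r0 (w.1 + 1, w.2)) (F (w.1 + 1, w.2)) := by
    intro w
    have hpt : ∀ u i, (if cfg.s u i = w then 1 else 0) =
        (if u = (w.1, w.2 - 1) then (if i % 4 = 0 then 1 else 0) else 0) +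
        (if u = (w.1 - 1, w.2) then (if i % 4 = 1 then 1 else 0) else 0) +
        (if u = (w.1, w.2 + 1) then (if i % 4 = 2 then 1 else 0) else 0) +
        (if u = (w.1 + 1, w.2) then (if i % 4 = 3 then 1 else 0) else 0) := by
      intro u i
      obtain ⟨s0, s1, s2, s3⟩ := hs u
      have h4 : i % 4 = 0 ∨ i % 4 = 1 ∨ i % 4 = 2 ∨ i % 4 = 3 := by omega
      rw [hmod u i]
      rcases h4 with h | h | h | h <;> rw [h]
      · rw [s0]; simp [Prod.ext_iff, eq_sub_iff_add_eq]
      · rw [s1]; simp [Prod.ext_iff, eq_sub_iff_add_eq]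
      · rw [s2]; simp [Prod.ext_iff, sub_eq_iff_eq_add]
      · rw [s3]; simp [Prod.ext_iff, sub_eq_iff_eq_add]
    have hsum : ∀ (p : ZMod N × ZMod N) (d : ℕ), d < 4 →
        (∑ u, ∑ i ∈ Finset.Ico (cfg.r0 u) (F u),
          if u = p then (if i % 4 = d then 1 else 0) else 0) = RT.cnt d (cfg.r0 p) (F p) := by
      intro p d hd
      rw [Finset.sum_eq_single p]
      · simp only [if_true]
        exact RT.card_cnt d hd _ _ (Nat.le_add_right _ _)
      · intro u _ hu; simp [hu]
      · simp
    unfold RT.ent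
    simp only [hpt, Finset.sum_add_distrib]
    rw [hsum _ 0 (by omega), hsum _ 1 (by omega), hsum _ 2 (by omega), hsum _ 3 (by omega)]
  have hcn := fun u : ZMod N × ZMod N =>
    RT.cnts hL (hb u.1).1 (hb u.1).2 (hb u.2).1 (hb u.2).2
  have hbal : ∀ w, RT.ent cfg F w + cfg.r0 w + (if w = (0, 0) then 1 else 0)
      = F w + if w = v then 1 else 0 := by
    intro w
    have h1 := RT.balance hL (hb w.1).1 (hb w.1).2 (hb w.2).1 (hb w.2).2
    have c0 := (hcn (w.1, w.2 - 1)).1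
    have c1 := (hcn (w.1 - 1, w.2)).2.1
    have c2 := (hcn (w.1, w.2 + 1)).2.2.1
    have c3 := (hcn (w.1 + 1, w.2)).2.2.2
    have hnn := RT.fz_nonneg (hb w.1).1 (hb w.1).2 (hb w.2).1 (hb w.2).2
    have i1 : w = (0, 0) ↔ (signedRep w.1 = 0 ∧ signedRep w.2 = 0) := by
      rw [Prod.ext_iff, hinj, hinj w.2, hs0]
    have i2 : w = v ↔ (signedRep w.1 = l ∧ signedRep w.2 = l) := by
      rw [Prod.ext_iff, hinj, hinj w.2, hsl]
    simp only [RT.sr_add l hN, RT.sr_sub l hN] at c0 c1 c2 c3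
    rw [hent]
    simp only [F, f, hr, RT.sr_add l hN, RT.sr_sub l hN, i1, i2]
    rw [← c0, ← c1, ← c2, ← c3] at h1
    split_ifs at h1 ⊢ <;> omega
  have hrank : ∀ u, cfg.r0 u < F u →
      (fun u : ZMod N × ZMod N => RT.rk l (signedRep u.1) (signedRep u.2)) (cfg.s u (F u - 1))
        < (fun u : ZMod N × ZMod N => RT.rk l (signedRep u.1) (signedRep u.2)) u := by
    intro u hu
    have hfp : 0 < RT.fz l (signedRep u.1) (signedRep u.2) := by
      simp only [F, f] at hu; omega
    obtain ⟨k0, k1, k2, k3⟩ := RT.rank hL (hb u.1).1 (hb u.1).2 (hb u.2).1 (hb u.2).2 hfp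
    obtain ⟨s0, s1, s2, s3⟩ := hs u
    rw [hmod]
    have hFu : F u = RT.r0 (signedRep u.1) (signedRep u.2) +
      (RT.fz l (signedRep u.1) (signedRep u.2)).toNat := by simp only [F, f, hr]
    rw [← hFu] at k0 k1 k2 k3
    have h4 : (F u - 1) % 4 = 0 ∨ (F u - 1) % 4 = 1 ∨ (F u - 1) % 4 = 2 ∨ (F u - 1) % 4 = 3 := by
      omega
    rcases h4 with h | h | h | h <;> rw [h]
    · rw [s0]; simpa only [RT.sr_add l hN] using k0 h
    · rw [s1]; simpa only [RT.sr_add l hN] using k1 h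
    · rw [s2]; simpa only [RT.sr_sub l hN] using k2 h
    · rw [s3]; simpa only [RT.sr_sub l hN] using k3 h
  obtain ⟨s, hst, hsv⟩ := hcov v
  have hmain := RT.abs_main cfg (0, 0) v F (fun u => Nat.le_add_right _ _) hbal
    (fun u : ZMod N × ZMod N => RT.rk l (signedRep u.1) (signedRep u.2)) hrank s hsv
  have hfs : ∑ u, f u ≤ t := by
    simp only [F, Finset.sum_add_distrib] at hmain
    omega
  have hfz : ((∑ u, f u : ℕ) : ℤ) =
      ∑ x ∈ Finset.Icc (-(l:ℤ)) l, ∑ y ∈ Finset.Icc (-(l:ℤ)) l, RT.fz l x y := by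
    rw [← RT.sum_sr l hN (fun x => ∑ y ∈ Finset.Icc (-(l:ℤ)) l, RT.fz l x y),
      Fintype.sum_prod_type]
    push_cast
    refine Finset.sum_congr rfl fun a _ => ?_
    rw [← RT.sum_sr l hN (fun y => RT.fz l (signedRep a) y)]
    refine Finset.sum_congr rfl fun b _ => ?_
    exact Int.toNat_of_nonneg (RT.fz_nonneg (hb a).1 (hb a).2 (hb b).1 (hb b).2)
  have hz := RT.sum_fz l
  rw [← hfz] at hz
  have hfin : 16 * (l:ℤ)^3 + 24 * (l:ℤ)^2 + 8 * l ≤ 3 * (t:ℤ) := by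
    rw [← hz]; have : ((∑ u, f u : ℕ) : ℤ) ≤ t := by exact_mod_cast hfs
    omega
  have hfin' : 16 * (l:ℝ)^3 + 24 * (l:ℝ)^2 + 8 * l ≤ 3 * (t:ℝ) := by exact_mod_cast hfin
  linarith
end

section
/- Let G=(V,E) be a finite graph with minimum degree δ, let v ∈ V, and let i ≥ 0 be such that Γ^{i+1}(v) ≠ ∅, where Γ^k(v) is the set of vertices at graph distance exactly k from v. Then |E(Γ^i(v)) ∪ E(Γ^{i+1}(v)) ∪ E(Γ^{i+2}(v))| ≥ δ²/6, where E(S) denotes the set of edges of G having at least one endpoint in S. -/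
/-- Let `G` be a finite graph with minimum degree `δ`, let `v` be a
vertex and `i ≥ 0` be such that `Γ^{i+1}(v) ≠ ∅`, where `Γ^k(v)` is the set of vertices at
graph distance exactly `k` from `v`.  Then
`|E(Γ^i(v)) ∪ E(Γ^{i+1}(v)) ∪ E(Γ^{i+2}(v))| ≥ δ²/6`, where `E(S)` is the set of edges
with at least one endpoint in `S`. -/
theorem edges_near_sphere_ge_minDegree_sq_div_six
    {V : Type*} [Fintype V] (G : SimpleGraph V) [DecidableRel G.Adj]
    (v : V) (i : ℕ)
    (hne : ∃ u : V, G.Reachable v u ∧ G.dist v u = i + 1) :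
    ((G.minDegree : ℝ)) ^ 2 / 6 ≤
      (({e : Sym2 V | e ∈ G.edgeSet ∧ ∃ u ∈ e, G.Reachable v u ∧
          (G.dist v u = i ∨ G.dist v u = i + 1 ∨ G.dist v u = i + 2)}.ncard : ℝ)) := by
  classical
  obtain ⟨u, hu, hd⟩ := hne
  set T : Set (Sym2 V) := {e : Sym2 V | e ∈ G.edgeSet ∧ ∃ u ∈ e, G.Reachable v u ∧
          (G.dist v u = i ∨ G.dist v u = i + 1 ∨ G.dist v u = i + 2)} with hT
  have hN : ∀ w, G.Adj u w → G.Reachable v w ∧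
      (G.dist v w = i ∨ G.dist v w = i + 1 ∨ G.dist v w = i + 2) := by
    intro w hw
    have hr : G.Reachable v w := hu.trans hw.reachable
    obtain ⟨p, hp⟩ := hu.exists_walk_length_eq_dist
    obtain ⟨q, hq⟩ := hr.exists_walk_length_eq_dist
    have h1 := SimpleGraph.dist_le (p.concat hw)
    have h2 := SimpleGraph.dist_le (q.concat hw.symm)
    rw [SimpleGraph.Walk.length_concat] at h1 h2
    exact ⟨hr, by omega⟩
  have key : (G.neighborFinset u).card * G.minDegree ≤ T.toFinset.card * 2 := by
    apply Finset.card_mul_le_card_mul (fun (w : V) (e : Sym2 V) => w ∈ e)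
    · intro w hw
      rw [SimpleGraph.mem_neighborFinset] at hw
      refine (G.minDegree_le_degree w).trans ?_
      rw [← SimpleGraph.card_incidenceFinset_eq_degree]
      apply Finset.card_le_card
      intro e he
      rw [SimpleGraph.mem_incidenceFinset] at he
      rw [Finset.mem_bipartiteAbove, Set.mem_toFinset]
      exact ⟨⟨he.1, w, he.2, hN w hw⟩, he.2⟩
    · intro e he
      have : e.toFinset.card ≤ 2 := by
        rw [Sym2.card_toFinset]; split_ifs <;> omega
      refine le_trans (Finset.card_le_card ?_) this
      intro w hw
      rw [Finset.mem_bipartiteBelow] at hw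
      exact Sym2.mem_toFinset.2 hw.2
  rw [SimpleGraph.card_neighborFinset_eq_degree] at key
  have h3 := (Nat.mul_le_mul_right G.minDegree (G.minDegree_le_degree u)).trans key
  rw [Set.ncard_eq_toFinset_card']
  have h4 : (G.minDegree : ℝ) * G.minDegree ≤ T.toFinset.card * 2 := by exact_mod_cast h3
  nlinarith [sq_nonneg (G.minDegree : ℝ)]
end
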